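/- arXiv:0905.3841 — 6 statements merged into one kernel-verified Lean document; each statement's English description precedes it below -/
import Mathlib

section
/- For every r > 0 and all indices p, q ∈ {1,…,n}: ∫_{∂B_r(0)} Σ_{i,k,l=1}^n (∂_l H_{ik}(x))² x_p x_q dσ(x) = (2/(n(n+2))) |S^{n−1}| Σ_{i,k,l=1}^n (W_{ipkl} + W_{ilkp})(W_{iqkl} + W_{ilkq}) r^{n+3} + (1/(n(n+2))) |S^{n−1}| Σ_{i,j,k,l=1}^n (W_{ijkl} + W_{ilkj})² δ_{pq} r^{n+3}. -/
open scoped BigOperators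
open MeasureTheory

/-- The quadratic tensor field `H_{ik}(x) = ∑_{p,q} W_{ipkq} x_p x_q`. -/
noncomputable def Hten (n : ℕ) (W : Fin n → Fin n → Fin n → Fin n → ℝ)
    (i k : Fin n) (x : EuclideanSpace ℝ (Fin n)) : ℝ :=
  ∑ p, ∑ q, W i p k q * x p * x q

/-- Partial derivative in the `l`-th coordinate direction. -/
noncomputable def pder (n : ℕ) (l : Fin n) (f : EuclideanSpace ℝ (Fin n) → ℝ)
    (x : EuclideanSpace ℝ (Fin n)) : ℝ :=
  fderiv ℝ f x (EuclideanSpace.single l 1)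

/-- The (n−1)-dimensional surface measure on the sphere `{|x| = r}` in `ℝⁿ`, realized as
`r^{n-1}` times the pushforward of the canonical surface measure of the unit sphere
(`volume.toSphere`) under the dilation `ω ↦ r • ω`. -/
noncomputable def surfMeasure (n : ℕ) (r : ℝ) : Measure (EuclideanSpace ℝ (Fin n)) :=
  ENNReal.ofReal (r ^ (n - 1)) •
    Measure.map (fun ω : Metric.sphere (0 : EuclideanSpace ℝ (Fin n)) 1 =>
        r • (ω : EuclideanSpace ℝ (Fin n)))
      (volume : Measure (EuclideanSpace ℝ (Fin n))).toSphere

/-- `|S^{n−1}|`: the total surface measure of the unit sphere in `ℝⁿ`. -/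
noncomputable def sphereArea (n : ℕ) : ℝ :=
  ((volume : Measure (EuclideanSpace ℝ (Fin n))).toSphere Set.univ).toReal


/-- The self-map of the unit sphere induced by a linear isometry. -/
noncomputable def sphMap (n : ℕ) (e : EuclideanSpace ℝ (Fin n) ≃ₗᵢ[ℝ] EuclideanSpace ℝ (Fin n))
    (ω : Metric.sphere (0 : EuclideanSpace ℝ (Fin n)) 1) :
    Metric.sphere (0 : EuclideanSpace ℝ (Fin n)) 1 :=
  ⟨e ω, by simp⟩

lemma continuous_sphMap (n : ℕ)
    (e : EuclideanSpace ℝ (Fin n) ≃ₗᵢ[ℝ] EuclideanSpace ℝ (Fin n)) :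
    Continuous (sphMap n e) := by
  unfold sphMap
  exact Continuous.subtype_mk (e.continuous.comp continuous_subtype_val) _

open scoped Pointwise in
lemma map_sphMap (n : ℕ)
    (e : EuclideanSpace ℝ (Fin n) ≃ₗᵢ[ℝ] EuclideanSpace ℝ (Fin n)) :
    Measure.map (sphMap n e) (volume : Measure (EuclideanSpace ℝ (Fin n))).toSphere
      = (volume : Measure (EuclideanSpace ℝ (Fin n))).toSphere := by
  ext s hs
  have hm := (continuous_sphMap n e).measurable
  rw [Measure.map_apply hm hs, Measure.toSphere_apply' _ (hm hs), Measure.toSphere_apply' _ hs]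
  congr 1
  have h1 : (Set.Ioo (0 : ℝ) 1 • (Subtype.val '' (sphMap n e ⁻¹' s)) :
      Set (EuclideanSpace ℝ (Fin n)))
      = e ⁻¹' (Set.Ioo (0 : ℝ) 1 • (Subtype.val '' s)) := by
    ext x
    simp only [Set.mem_smul, Set.mem_image, Set.mem_preimage]
    constructor
    · rintro ⟨t, ht, y, ⟨ω, hω, rfl⟩, rfl⟩
      exact ⟨t, ht, _, ⟨_, hω, rfl⟩, by simp [sphMap]⟩
    · rintro ⟨t, ht, y, ⟨ω, hω, rfl⟩, hx⟩
      refine ⟨t, ht, e.symm ω, ⟨⟨e.symm ω, by simp⟩, ?_, rfl⟩, ?_⟩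
      · simpa [sphMap] using hω
      · apply e.injective
        simpa using hx
  rw [h1]
  exact e.measurePreserving.measure_preimage_equiv (f := e.toMeasurableEquiv) _

lemma integrable_sph (n : ℕ) (f : Metric.sphere (0 : EuclideanSpace ℝ (Fin n)) 1 → ℝ)
    (hf : Continuous f) :
    Integrable f (volume : Measure (EuclideanSpace ℝ (Fin n))).toSphere :=
  hf.integrable_of_hasCompactSupport (HasCompactSupport.of_compactSpace f)

/-- The fourth moment form. -/
noncomputable def mom4 (n : ℕ) (v : EuclideanSpace ℝ (Fin n)) : ℝ :=
  ∫ ω, (inner ℝ v (ω : EuclideanSpace ℝ (Fin n))) ^ 4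
    ∂(volume : Measure (EuclideanSpace ℝ (Fin n))).toSphere

lemma mom4_isom (n : ℕ) (e : EuclideanSpace ℝ (Fin n) ≃ₗᵢ[ℝ] EuclideanSpace ℝ (Fin n))
    (v : EuclideanSpace ℝ (Fin n)) : mom4 n (e v) = mom4 n v := by
  unfold mom4
  conv_lhs => rw [← map_sphMap n e]
  rw [integral_map (continuous_sphMap n e).aemeasurable]
  · simp [sphMap]
  · apply Continuous.aestronglyMeasurable
    fun_prop

lemma mom4_eq (n : ℕ) (hn : 3 ≤ n) : ∃ C : ℝ, ∀ v : EuclideanSpace ℝ (Fin n),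
    mom4 n v = 3 * C * (inner ℝ v v) ^ 2 := by
  let u : EuclideanSpace ℝ (Fin n) := EuclideanSpace.single ⟨0, by omega⟩ 1
  have hu : ‖u‖ = 1 := by simp [u]
  refine ⟨mom4 n u / 3, fun v => ?_⟩
  have h1 : ‖‖v‖ • u‖ = ‖v‖ := by simp [norm_smul, hu]
  have h2 := Submodule.reflection_sub h1
  rw [← h2, mom4_isom, h2, real_inner_self_eq_norm_sq]
  unfold mom4
  simp only [inner_smul_left, mul_pow]
  rw [integral_const_mul]
  simp
  ring

/-- Fourth moments with an unknown constant. -/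
lemma moment_aux (n : ℕ) (hn : 3 ≤ n) : ∃ C : ℝ, ∀ a b c d : EuclideanSpace ℝ (Fin n),
    ∫ ω, inner ℝ a (ω : EuclideanSpace ℝ (Fin n)) * inner ℝ b (ω : EuclideanSpace ℝ (Fin n)) *
      inner ℝ c (ω : EuclideanSpace ℝ (Fin n)) * inner ℝ d (ω : EuclideanSpace ℝ (Fin n))
    ∂(volume : Measure (EuclideanSpace ℝ (Fin n))).toSphere
    = C * (inner ℝ a b * inner ℝ c d + inner ℝ a c * inner ℝ b d + inner ℝ a d * inner ℝ b c) := by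
  obtain ⟨C, hC⟩ := mom4_eq n hn
  refine ⟨C, fun a b c d => ?_⟩
  have key : ∫ ω, inner ℝ a (ω : EuclideanSpace ℝ (Fin n)) *
      inner ℝ b (ω : EuclideanSpace ℝ (Fin n)) *
      inner ℝ c (ω : EuclideanSpace ℝ (Fin n)) * inner ℝ d (ω : EuclideanSpace ℝ (Fin n))
    ∂(volume : Measure (EuclideanSpace ℝ (Fin n))).toSphere
    = (1 / 384) * (2 * mom4 n (a + b + c + d) - 2 * mom4 n (a + b + c - d)
      - 2 * mom4 n (a + b - c + d) - 2 * mom4 n (a - b + c + d)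
      + 2 * mom4 n (a + b - c - d) + 2 * mom4 n (a - b + c - d) + 2 * mom4 n (a - b - c + d)
      - 2 * mom4 n (a - b - c - d)) := by
    unfold mom4
    simp only [← integral_const_mul]
    have hi : ∀ v : EuclideanSpace ℝ (Fin n), Integrable
      (fun ω : Metric.sphere (0 : EuclideanSpace ℝ (Fin n)) 1 =>
        2 * (inner ℝ v (ω : EuclideanSpace ℝ (Fin n))) ^ 4)
        (volume : Measure (EuclideanSpace ℝ (Fin n))).toSphere := fun v =>
      integrable_sph n _ (by fun_prop)
    rw [← integral_sub (hi _) (hi _), ← integral_sub (integrable_sph n _ (by fun_prop)) (hi _),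
      ← integral_sub (integrable_sph n _ (by fun_prop)) (hi _),
      ← integral_add (integrable_sph n _ (by fun_prop)) (hi _),
      ← integral_add (integrable_sph n _ (by fun_prop)) (hi _),
      ← integral_add (integrable_sph n _ (by fun_prop)) (hi _),
      ← integral_sub (integrable_sph n _ (by fun_prop)) (hi _), ← integral_const_mul]
    congr 1
    ext ω
    simp only [inner_add_left, inner_sub_left]
    ring
  rw [key]
  simp only [hC, inner_add_left, inner_sub_left, inner_add_right, inner_sub_right]
  rw [real_inner_comm a b, real_inner_comm a c, real_inner_comm a d, real_inner_comm b c,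
    real_inner_comm b d, real_inner_comm c d]
  ring

lemma moment (n : ℕ) (hn : 3 ≤ n) (a b c d : EuclideanSpace ℝ (Fin n)) :
    ∫ ω, inner ℝ a (ω : EuclideanSpace ℝ (Fin n)) * inner ℝ b (ω : EuclideanSpace ℝ (Fin n)) *
      inner ℝ c (ω : EuclideanSpace ℝ (Fin n)) * inner ℝ d (ω : EuclideanSpace ℝ (Fin n))
    ∂(volume : Measure (EuclideanSpace ℝ (Fin n))).toSphere
    = sphereArea n / ((n : ℝ) * ((n : ℝ) + 2)) *
      (inner ℝ a b * inner ℝ c d + inner ℝ a c * inner ℝ b d + inner ℝ a d * inner ℝ b c) := by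
  obtain ⟨C, hC⟩ := moment_aux n hn
  suffices h : sphereArea n = C * ((n : ℝ) * ((n : ℝ) + 2)) by
    have hn' : (0 : ℝ) < n := by exact_mod_cast (by omega : 0 < n)
    rw [hC, h]
    field_simp
  let u : Fin n → EuclideanSpace ℝ (Fin n) := fun i => EuclideanSpace.single i 1
  have h1 : sphereArea n = ∫ ω, ∑ i, ∑ j, inner ℝ (u i) (ω : EuclideanSpace ℝ (Fin n)) *
      inner ℝ (u i) (ω : EuclideanSpace ℝ (Fin n)) *
      inner ℝ (u j) (ω : EuclideanSpace ℝ (Fin n)) * inner ℝ (u j) (ω : EuclideanSpace ℝ (Fin n))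
      ∂(volume : Measure (EuclideanSpace ℝ (Fin n))).toSphere := by
    have : ∀ ω : Metric.sphere (0 : EuclideanSpace ℝ (Fin n)) 1,
      ∑ i, ∑ j, inner ℝ (u i) (ω : EuclideanSpace ℝ (Fin n)) *
      inner ℝ (u i) (ω : EuclideanSpace ℝ (Fin n)) *
      inner ℝ (u j) (ω : EuclideanSpace ℝ (Fin n)) *
      inner ℝ (u j) (ω : EuclideanSpace ℝ (Fin n)) = 1 := by
      intro ω
      have hω : ∑ i, (ω : EuclideanSpace ℝ (Fin n)) i * (ω : EuclideanSpace ℝ (Fin n)) i = 1 := by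
        have h2 : ‖(ω : EuclideanSpace ℝ (Fin n))‖ ^ 2 = 1 := by simp
        rw [EuclideanSpace.real_norm_sq_eq] at h2
        simpa [sq] using h2
      simp only [u, EuclideanSpace.inner_single_left, map_one, one_mul, mul_assoc]
      simp only [← mul_assoc]
      calc _ = (∑ i, (ω : EuclideanSpace ℝ (Fin n)) i * (ω : EuclideanSpace ℝ (Fin n)) i) *
            (∑ i, (ω : EuclideanSpace ℝ (Fin n)) i * (ω : EuclideanSpace ℝ (Fin n)) i) := by
            rw [Finset.sum_mul_sum]
            simp only [← mul_assoc]
        _ = 1 := by rw [hω, one_mul]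
    simp only [this]
    simp only [integral_const, smul_eq_mul, mul_one]
    rfl
  rw [h1, integral_finsetSum _ (fun i _ => integrable_sph n _ (by fun_prop))]
  have h3 : ∀ i, ∫ ω, ∑ j, inner ℝ (u i) (ω : EuclideanSpace ℝ (Fin n)) *
      inner ℝ (u i) (ω : EuclideanSpace ℝ (Fin n)) *
      inner ℝ (u j) (ω : EuclideanSpace ℝ (Fin n)) * inner ℝ (u j) (ω : EuclideanSpace ℝ (Fin n))
      ∂(volume : Measure (EuclideanSpace ℝ (Fin n))).toSphere = C * (n + 2) := by
    intro i
    rw [integral_finsetSum _ (fun i _ => integrable_sph n _ (by fun_prop))]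
    simp only [hC]
    have h4 : ∀ j, inner ℝ (u i) (u i) * inner ℝ (u j) (u j) + inner ℝ (u i) (u j) *
        inner ℝ (u i) (u j) + inner ℝ (u i) (u j) * inner ℝ (u i) (u j)
        = 1 + (if i = j then (2 : ℝ) else 0) := by
      intro j
      simp only [u, EuclideanSpace.inner_single_left, map_one, one_mul, PiLp.single_apply]
      split_ifs <;> norm_num
    simp only [h4]
    rw [← Finset.mul_sum, Finset.sum_add_distrib]
    simp
  simp only [h3]
  simp
  ring

lemma pder_Hten (n : ℕ) (W : Fin n → Fin n → Fin n → Fin n → ℝ) (i k l : Fin n)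
    (x : EuclideanSpace ℝ (Fin n)) :
    pder n l (Hten n W i k) x
      = inner ℝ (WithLp.toLp 2 (fun a => W i a k l + W i l k a)) x := by
  unfold pder
  have hc : ∀ a : Fin n, HasFDerivAt (fun x : EuclideanSpace ℝ (Fin n) => x a)
      (EuclideanSpace.proj a : EuclideanSpace ℝ (Fin n) →L[ℝ] ℝ) x := fun a =>
    (EuclideanSpace.proj a : EuclideanSpace ℝ (Fin n) →L[ℝ] ℝ).hasFDerivAt
  have h : HasFDerivAt (Hten n W i k) _ x :=
    HasFDerivAt.fun_sum (u := Finset.univ) fun a _ =>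
      HasFDerivAt.fun_sum (u := Finset.univ) fun b _ =>
        ((hc a).const_mul (W i a k b)).mul (hc b)
  rw [h.fderiv]
  simp [PiLp.inner_apply, PiLp.single_apply, Finset.sum_add_distrib, mul_add]
  exact Finset.sum_congr rfl fun a _ => mul_comm _ _

theorem stmt_5 (n : ℕ) (hn : 3 ≤ n) (W : Fin n → Fin n → Fin n → Fin n → ℝ)
    (hsymm1 : ∀ i j k l, W i j k l = - W j i k l)
    (hsymm2 : ∀ i j k l, W i j k l = - W i j l k)
    (hsymm3 : ∀ i j k l, W i j k l = W k l i j)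
    (hBianchi : ∀ i j k l, W i j k l + W i k l j + W i l j k = 0)
    (htrace : ∀ j l, ∑ i, W i j i l = 0)
    (r : ℝ) (hr : 0 < r) (p q : Fin n) :
    ∫ x, (∑ i, ∑ k, ∑ l, (pder n l (Hten n W i k) x) ^ 2) * x p * x q
        ∂(surfMeasure n r)
      = 2 / ((n : ℝ) * ((n : ℝ) + 2)) * sphereArea n *
          (∑ i, ∑ k, ∑ l, (W i p k l + W i l k p) * (W i q k l + W i l k q)) * r ^ (n + 3)
        + 1 / ((n : ℝ) * ((n : ℝ) + 2)) * sphereArea n *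
          (∑ i, ∑ j, ∑ k, ∑ l, (W i j k l + W i l k j) ^ 2) *
          (if p = q then 1 else 0) * r ^ (n + 3) := by
  simp only [pder_Hten]
  set v : Fin n → Fin n → Fin n → EuclideanSpace ℝ (Fin n) :=
    fun i k l => WithLp.toLp 2 (fun a => W i a k l + W i l k a) with hv
  have hpow : r ^ (n + 3) = r ^ (n - 1) * r ^ 4 := by
    rw [← pow_add]; congr 1; omega
  have hI : ∀ i k l, ∫ ω, inner ℝ (v i k l) (ω : EuclideanSpace ℝ (Fin n)) *
      inner ℝ (v i k l) (ω : EuclideanSpace ℝ (Fin n)) *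
      inner ℝ (EuclideanSpace.single p (1 : ℝ)) (ω : EuclideanSpace ℝ (Fin n)) *
      inner ℝ (EuclideanSpace.single q (1 : ℝ)) (ω : EuclideanSpace ℝ (Fin n))
      ∂(volume : Measure (EuclideanSpace ℝ (Fin n))).toSphere
      = sphereArea n / ((n : ℝ) * ((n : ℝ) + 2)) *
        ((∑ j, (W i j k l + W i l k j) ^ 2) * (if p = q then 1 else 0) +
          2 * ((W i p k l + W i l k p) * (W i q k l + W i l k q))) := by
    intro i k l
    rw [moment n hn]
    have e1 : inner ℝ (v i k l) (v i k l) = ∑ j, (W i j k l + W i l k j) ^ 2 := by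
      rw [real_inner_self_eq_norm_sq, EuclideanSpace.real_norm_sq_eq]
    have e2 : ∀ a, inner ℝ (v i k l) (EuclideanSpace.single a (1 : ℝ))
        = W i a k l + W i l k a := by
      intro a
      rw [EuclideanSpace.inner_single_right]
      simp [hv]
    rw [e1, e2, e2]
    simp only [EuclideanSpace.inner_single_left, map_one, one_mul, PiLp.single_apply]
    ring
  unfold surfMeasure
  rw [integral_smul_measure, ENNReal.toReal_ofReal (by positivity), integral_map
    (by fun_prop) (by apply Continuous.aestronglyMeasurable; fun_prop)]
  have hint : ∀ ω : Metric.sphere (0 : EuclideanSpace ℝ (Fin n)) 1,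
      (∑ i, ∑ k, ∑ l, (inner ℝ (v i k l) (r • (ω : EuclideanSpace ℝ (Fin n)))) ^ 2) *
        (r • (ω : EuclideanSpace ℝ (Fin n))) p * (r • (ω : EuclideanSpace ℝ (Fin n))) q
      = r ^ 4 * ∑ i, ∑ k, ∑ l, inner ℝ (v i k l) (ω : EuclideanSpace ℝ (Fin n)) *
      inner ℝ (v i k l) (ω : EuclideanSpace ℝ (Fin n)) *
      inner ℝ (EuclideanSpace.single p (1 : ℝ)) (ω : EuclideanSpace ℝ (Fin n)) *
      inner ℝ (EuclideanSpace.single q (1 : ℝ)) (ω : EuclideanSpace ℝ (Fin n)) := by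
    intro ω
    simp only [Finset.sum_mul, Finset.mul_sum]
    refine Finset.sum_congr rfl fun i _ => Finset.sum_congr rfl fun k _ =>
      Finset.sum_congr rfl fun l _ => ?_
    simp only [EuclideanSpace.inner_single_left, map_one, one_mul, inner_smul_right,
      PiLp.smul_apply, smul_eq_mul]
    ring
  have hsum : ∫ ω, ∑ i, ∑ k, ∑ l, inner ℝ (v i k l) (ω : EuclideanSpace ℝ (Fin n)) *
      inner ℝ (v i k l) (ω : EuclideanSpace ℝ (Fin n)) *
      inner ℝ (EuclideanSpace.single p (1 : ℝ)) (ω : EuclideanSpace ℝ (Fin n)) *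
      inner ℝ (EuclideanSpace.single q (1 : ℝ)) (ω : EuclideanSpace ℝ (Fin n))
      ∂(volume : Measure (EuclideanSpace ℝ (Fin n))).toSphere
      = ∑ i, ∑ k, ∑ l, sphereArea n / ((n : ℝ) * ((n : ℝ) + 2)) *
        ((∑ j, (W i j k l + W i l k j) ^ 2) * (if p = q then 1 else 0) +
          2 * ((W i p k l + W i l k p) * (W i q k l + W i l k q))) := by
    rw [integral_finsetSum _ (fun i _ => integrable_sph n _ (by fun_prop))]
    refine Finset.sum_congr rfl fun i _ => ?_
    rw [integral_finsetSum _ (fun i _ => integrable_sph n _ (by fun_prop))]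
    refine Finset.sum_congr rfl fun k _ => ?_
    rw [integral_finsetSum _ (fun i _ => integrable_sph n _ (by fun_prop))]
    exact Finset.sum_congr rfl fun l _ => hI i k l
  refine (congrArg _ (integral_congr_ae (Filter.Eventually.of_forall hint))).trans ?_
  rw [integral_const_mul, hsum, hpow]
  have hre : (∑ i, ∑ j, ∑ k, ∑ l, (W i j k l + W i l k j) ^ 2)
      = ∑ i, ∑ k, ∑ l, ∑ j, (W i j k l + W i l k j) ^ 2 := by
    refine Finset.sum_congr rfl fun i _ => ?_
    rw [Finset.sum_comm]
    refine Finset.sum_congr rfl fun k _ => ?_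
    rw [Finset.sum_comm]
  rw [hre]
  simp only [← Finset.mul_sum, Finset.sum_add_distrib, ← Finset.sum_mul, smul_eq_mul]
  ring
end

section
/- For every r > 0 and all indices p, q ∈ {1,…,n}: ∫_{∂B_r(0)} Σ_{i,k=1}^n H_{ik}(x)² x_p x_q dσ(x) = (2/(n(n+2)(n+4))) |S^{n−1}| Σ_{i,k,l=1}^n (W_{ipkl} + W_{ilkp})(W_{iqkl} + W_{ilkq}) r^{n+5} + (1/(2n(n+2)(n+4))) |S^{n−1}| Σ_{i,j,k,l=1}^n (W_{ijkl} + W_{ilkj})² δ_{pq} r^{n+5}. -/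
open scoped BigOperators
open MeasureTheory

noncomputable def mon {n : ℕ} (L : List (Fin n)) (x : EuclideanSpace ℝ (Fin n)) : ℝ :=
  (L.map fun i => x i).prod

noncomputable def gau {n : ℕ} (x : EuclideanSpace ℝ (Fin n)) : ℝ :=
  Real.exp (-(1 / 2) * ‖x‖ ^ 2)

noncomputable def radI (m : ℕ) : ℝ :=
  ∫ y in Set.Ioi (0 : ℝ), y ^ m * Real.exp (-(1 / 2) * y ^ 2)

lemma mon_nil {n : ℕ} (x : EuclideanSpace ℝ (Fin n)) : mon [] x = 1 := by simp [mon]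

lemma mon_cons {n : ℕ} (a : Fin n) (L : List (Fin n)) (x : EuclideanSpace ℝ (Fin n)) :
    mon (a :: L) x = x a * mon L x := by simp [mon]

lemma mon_append {n : ℕ} (P L : List (Fin n)) (x : EuclideanSpace ℝ (Fin n)) :
    mon (P ++ L) x = mon P x * mon L x := by simp [mon]

lemma mon_smul {n : ℕ} (L : List (Fin n)) (c : ℝ) (x : EuclideanSpace ℝ (Fin n)) :
    mon L (c • x) = c ^ L.length * mon L x := by
  induction L with
  | nil => simp [mon_nil]
  | cons a L ih => rw [mon_cons, mon_cons, ih]; simp [pow_succ]; ring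

lemma mon_abs_le {n : ℕ} (L : List (Fin n)) (x : EuclideanSpace ℝ (Fin n)) :
    |mon L x| ≤ ‖x‖ ^ L.length := by
  induction L with
  | nil => simp [mon_nil]
  | cons a L ih =>
    rw [mon_cons, abs_mul, List.length_cons, pow_succ']
    have : |x a| ≤ ‖x‖ := by simpa using PiLp.norm_apply_le x a
    gcongr

lemma mon_continuous {n : ℕ} (L : List (Fin n)) : Continuous (mon L) := by
  induction L with
  | nil => simpa [mon_nil, funext_iff] using (continuous_const : Continuous fun _ => (1:ℝ)).congr (fun x => (mon_nil x).symm)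
  | cons a L ih =>
    have : mon (a :: L) = fun x => x a * mon L x := funext (mon_cons a L)
    rw [this]; fun_prop

lemma mon_differentiable {n : ℕ} (L : List (Fin n)) : Differentiable ℝ (mon L) := by
  induction L with
  | nil =>
    have : mon ([] : List (Fin n)) = fun _ => 1 := funext mon_nil
    rw [this]; fun_prop
  | cons a L ih =>
    have : mon (a :: L) = fun x => x a * mon L x := funext (mon_cons a L)
    rw [this]; fun_prop

lemma gau_continuous {n : ℕ} : Continuous (gau (n := n)) := by
  unfold gau; fun_prop

lemma rad_integrable (m : ℕ) :
    IntegrableOn (fun y : ℝ => y ^ m * Real.exp (-(1 / 2) * y ^ 2)) (Set.Ioi 0) := by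
  have := integrableOn_rpow_mul_exp_neg_mul_sq (b := 1 / 2) (by norm_num) (s := m)
    (by have : (0:ℝ) ≤ m := by positivity
        linarith)
  simpa using this

lemma radI_eq (m : ℕ) : radI m = (1 / 2 : ℝ) ^ (-((m:ℝ) + 1) / 2) * (1 / 2)
    * Real.Gamma (((m:ℝ) + 1) / 2) := by
  have h := integral_rpow_mul_exp_neg_mul_rpow (p := 2) (q := m) (b := 1 / 2) (by norm_num)
    (by have : (0:ℝ) ≤ m := by positivity
        linarith) (by norm_num)
  rw [← h]
  unfold radI
  simp

lemma radI_pos (m : ℕ) : 0 < radI m := by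
  rw [radI_eq]
  have := Real.Gamma_pos_of_pos (s := ((m:ℝ) + 1) / 2) (by positivity)
  positivity

lemma radI_succ (m : ℕ) : radI (m + 2) = (m + 1) * radI m := by
  rw [radI_eq, radI_eq]
  have e1 : (((m + 2 : ℕ) : ℝ) + 1) / 2 = ((m:ℝ) + 1) / 2 + 1 := by push_cast; ring
  have e2 : -(((m + 2 : ℕ) : ℝ) + 1) / 2 = -((m:ℝ) + 1) / 2 - 1 := by push_cast; ring
  rw [e1, e2, Real.Gamma_add_one (by positivity), Real.rpow_sub_one (by norm_num)]
  ring

lemma mon_gau_integrable {n : ℕ} (hn : 3 ≤ n) (L : List (Fin n)) :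
    Integrable (fun x : EuclideanSpace ℝ (Fin n) => mon L x * gau x) := by
  have : Nonempty (Fin n) := ⟨⟨0, by omega⟩⟩
  have h : Integrable (fun x : EuclideanSpace ℝ (Fin n) =>
      (fun y : ℝ => y ^ L.length * Real.exp (-(1 / 2) * y ^ 2)) ‖x‖) := by
    refine (integrable_fun_norm_addHaar volume (f := fun y : ℝ => y ^ L.length * Real.exp (-(1 / 2) * y ^ 2))).2 ?_
    refine (rad_integrable (n - 1 + L.length)).congr_fun (fun y _ => ?_) measurableSet_Ioi
    simp [pow_add]; ring
  refine h.mono' ((mon_continuous L).mul gau_continuous).aestronglyMeasurable (.of_forall fun x => ?_)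
  rw [norm_mul, Real.norm_eq_abs, gau, Real.norm_of_nonneg (Real.exp_pos _).le]
  exact mul_le_mul_of_nonneg_right (mon_abs_le L x) (Real.exp_pos _).le

/-- directional derivative of a monomial -/
noncomputable def dmon {n : ℕ} (a : Fin n) : List (Fin n) → EuclideanSpace ℝ (Fin n) → ℝ
  | [], _ => 0
  | b :: L, x => (if a = b then 1 else 0) * mon L x + x b * dmon a L x

lemma fderiv_mon {n : ℕ} (a : Fin n) (L : List (Fin n)) (x : EuclideanSpace ℝ (Fin n)) :
    fderiv ℝ (mon L) x (EuclideanSpace.single a 1) = dmon a L x := by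
  induction L with
  | nil =>
    have : mon ([] : List (Fin n)) = fun _ => 1 := funext mon_nil
    rw [this]; simp [dmon]
  | cons b L ih =>
    have : mon (b :: L) = fun x => EuclideanSpace.proj (𝕜 := ℝ) b x * mon L x := funext (mon_cons b L)
    rw [this, fderiv_fun_mul (by fun_prop) (mon_differentiable L x)]
    simp only [ContinuousLinearMap.fderiv, dmon, ← ih]
    simp [eq_comm]
    ring

lemma fderiv_gau {n : ℕ} (a : Fin n) (x : EuclideanSpace ℝ (Fin n)) :
    DifferentiableAt ℝ gau x ∧
    fderiv ℝ gau x (EuclideanSpace.single a 1) = -(x a * gau x) := by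
  have h1 := ((hasStrictFDerivAt_norm_sq x).hasFDerivAt.const_mul (-(1 / 2) : ℝ)).exp
  have h2 : HasFDerivAt gau _ x := h1
  refine ⟨h2.differentiableAt, ?_⟩
  rw [h2.fderiv]
  simp [gau, EuclideanSpace.inner_single_right]
  ring

/-- Gaussian moment -/
noncomputable def gM {n : ℕ} (L : List (Fin n)) : ℝ :=
  ∫ x : EuclideanSpace ℝ (Fin n), mon L x * gau x

noncomputable def gS {n : ℕ} (a : Fin n) : List (Fin n) → List (Fin n) → ℝ
  | _, [] => 0
  | P, b :: L => (if a = b then 1 else 0) * gM (P ++ L) + gS a (P ++ [b]) L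

lemma dmon_int {n : ℕ} (hn : 3 ≤ n) (a : Fin n) (P L : List (Fin n)) :
    Integrable (fun x : EuclideanSpace ℝ (Fin n) => mon P x * dmon a L x * gau x) ∧
    ∫ x : EuclideanSpace ℝ (Fin n), mon P x * dmon a L x * gau x = gS a P L := by
  induction L generalizing P with
  | nil => simp [dmon, gS]
  | cons b L ih =>
    obtain ⟨i1, i2⟩ := ih (P ++ [b])
    have i3 := (mon_gau_integrable hn (P ++ L)).const_mul (if a = b then (1:ℝ) else 0)
    have e : (fun x : EuclideanSpace ℝ (Fin n) => mon P x * dmon a (b :: L) x * gau x) =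
      fun x => (if a = b then (1:ℝ) else 0) * (mon (P ++ L) x * gau x) +
        mon (P ++ [b]) x * dmon a L x * gau x := by
      funext x
      rw [dmon, mon_append, mon_append, mon_cons, mon_nil]; ring
    refine ⟨by rw [e]; exact i3.add i1, ?_⟩
    rw [e, integral_add i3 i1, i2, integral_const_mul, gS, gM]

lemma stein {n : ℕ} (hn : 3 ≤ n) (a : Fin n) (L : List (Fin n)) :
    gM (a :: L) = gS a [] L := by
  obtain ⟨i1, i2⟩ := dmon_int hn a [] L
  simp only [mon_nil, one_mul] at i1 i2
  have h := integral_mul_fderiv_eq_neg_fderiv_mul_of_integrable (μ := volume)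
    (f := mon L) (g := gau) (v := EuclideanSpace.single a (1:ℝ))
    (by simpa only [fderiv_mon] using i1)
    (by
      simp only [(fderiv_gau a _).2]
      refine (mon_gau_integrable hn (a :: L)).neg.congr (.of_forall fun x => ?_)
      simp [mon_cons]; ring)
    (mon_gau_integrable hn L) (fun x _ => mon_differentiable L x) (fun x _ => (fderiv_gau a x).1)
  simp only [fderiv_mon, (fderiv_gau a _).2, i2] at h
  rw [gM, ← neg_inj, ← h, ← integral_neg]
  congr 1; funext x; rw [mon_cons]; ring

lemma polar {n : ℕ} (hn : 3 ≤ n) (L : List (Fin n)) :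
    gM L = (∫ ω : Metric.sphere (0 : EuclideanSpace ℝ (Fin n)) 1, mon L ω.1
      ∂(volume : Measure (EuclideanSpace ℝ (Fin n))).toSphere) * radI (n - 1 + L.length) := by
  have : Nonempty (Fin n) := ⟨⟨0, by omega⟩⟩
  let μ := (volume : Measure (EuclideanSpace ℝ (Fin n)))
  calc
    gM L = ∫ x : ({(0)}ᶜ : Set (EuclideanSpace ℝ (Fin n))), mon L x.1 * gau x.1 ∂(μ.comap (↑)) := by
      rw [integral_subtype_comap (measurableSet_singleton _).compl fun x ↦ mon L x * gau x,
        restrict_compl_singleton, gM]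
    _ = ∫ x, mon L x.1.1 * (x.2.1 ^ L.length * Real.exp (-(1 / 2) * x.2.1 ^ 2))
        ∂μ.toSphere.prod (.volumeIoiPow (Module.finrank ℝ (EuclideanSpace ℝ (Fin n)) - 1)) := by
      rw [← μ.measurePreserving_homeomorphUnitSphereProd.integral_comp
        (Homeomorph.measurableEmbedding _)]
      congr 1; funext x
      have hx : ‖x.1‖ ≠ 0 := norm_ne_zero_iff.2 x.2
      simp only [homeomorphUnitSphereProd_apply_snd_coe, homeomorphUnitSphereProd_apply_fst_coe,
        mon_smul, gau]
      field_simp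
      rw [mul_assoc, ← mul_pow, one_div_mul_cancel hx, one_pow, mul_one]
    _ = (∫ ω, mon L ω.1 ∂μ.toSphere) * ∫ x : Set.Ioi (0 : ℝ), (x.1 ^ L.length *
        Real.exp (-(1 / 2) * x.1 ^ 2)) ∂.volumeIoiPow
          (Module.finrank ℝ (EuclideanSpace ℝ (Fin n)) - 1) :=
      integral_prod_mul (fun ω : Metric.sphere (0 : EuclideanSpace ℝ (Fin n)) 1 => mon L ω.1)
        (fun x : Set.Ioi (0 : ℝ) => (x.1 ^ L.length * Real.exp (-(1 / 2) * x.1 ^ 2)))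
    _ = _ := by
      congr 1
      simp only [Measure.volumeIoiPow, ENNReal.ofReal]
      rw [integral_withDensity_eq_integral_smul,
        integral_subtype_comap measurableSet_Ioi fun a ↦ Real.toNNReal (a ^ (Module.finrank ℝ (EuclideanSpace ℝ (Fin n)) - 1)) • (a ^ L.length * Real.exp (-(1 / 2) * a ^ 2)),
        setIntegral_congr_fun measurableSet_Ioi fun x hx ↦ ?_, radI]
      · change Real.toNNReal _ • _ = _
        rw [NNReal.smul_def, Real.coe_toNNReal _ (pow_nonneg hx.out.le _)]
        simp [pow_add]; ring
      · exact (measurable_subtype_coe.pow_const _).real_toNNReal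
noncomputable def kd {n : ℕ} (a b : Fin n) : ℝ := if a = b then 1 else 0

noncomputable def wick {n : ℕ} (p q a b c d : Fin n) : ℝ :=
  kd p q * (kd a b * kd c d + kd a c * kd b d + kd a d * kd b c)
  + kd p a * (kd q b * kd c d + kd q c * kd b d + kd q d * kd b c)
  + kd p b * (kd q a * kd c d + kd q c * kd a d + kd q d * kd a c)
  + kd p c * (kd q a * kd b d + kd q b * kd a d + kd q d * kd a b)
  + kd p d * (kd q a * kd b c + kd q b * kd a c + kd q c * kd a b)

lemma gM_six {n : ℕ} (hn : 3 ≤ n) (p q a b c d : Fin n) :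
    gM [p, q, a, b, c, d] = wick p q a b c d * gM ([] : List (Fin n)) := by
  simp only [stein hn, gS, List.nil_append, List.cons_append, wick, kd]
  ring

lemma sphere_six {n : ℕ} (hn : 3 ≤ n) (p q a b c d : Fin n) :
    ∫ ω : Metric.sphere (0 : EuclideanSpace ℝ (Fin n)) 1, mon [p, q, a, b, c, d] ω.1
      ∂(volume : Measure (EuclideanSpace ℝ (Fin n))).toSphere
    = wick p q a b c d * sphereArea n / ((n : ℝ) * ((n : ℝ) + 2) * ((n : ℝ) + 4)) := by
  have h := gM_six hn p q a b c d
  rw [polar hn, polar hn] at h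
  have h0 : ∫ ω : Metric.sphere (0 : EuclideanSpace ℝ (Fin n)) 1, mon [] ω.1
      ∂(volume : Measure (EuclideanSpace ℝ (Fin n))).toSphere = sphereArea n := by
    simp [mon_nil, sphereArea, Measure.real]
  rw [h0] at h
  obtain ⟨m, rfl⟩ : ∃ m, n = m + 1 := ⟨n - 1, by omega⟩
  simp only [List.length_cons, List.length_nil, Nat.add_sub_cancel, zero_add, add_zero] at h
  have e : radI (m + (1 + 1 + 1 + 1 + 1 + 1)) = (m + 5) * ((m + 3) * ((m + 1) * radI m)) := by
    rw [← radI_succ m, show m + (1 + 1 + 1 + 1 + 1 + 1) = (m + 2 + 2) + 2 by ring, radI_succ,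
      radI_succ]
    push_cast; ring
  rw [e] at h
  have := radI_pos m
  push_cast
  rw [eq_div_iff (by positivity)]
  apply mul_right_cancel₀ this.ne'
  linear_combination h

lemma sum_kd {n : ℕ} (p : Fin n) (f : Fin n → ℝ) : ∑ a, kd p a * f a = f p := by
  simp [kd]

lemma contract {n : ℕ} (A : Fin n → Fin n → ℝ) (hA : ∑ a, A a a = 0) (p q : Fin n) :
    ∑ a, ∑ b, ∑ c, ∑ d, A a b * A c d * wick p q a b c d =
      1 / 2 * (∑ a, ∑ b, (A a b + A b a) ^ 2) * kd p q
      + 2 * ∑ l, (A p l + A l p) * (A q l + A l q) := by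
  have t1 : ∑ a, ∑ b, A b a ^ 2 = ∑ a, ∑ b, A a b ^ 2 := Finset.sum_comm
  simp only [wick, kd, mul_add, add_mul, Finset.sum_add_distrib, mul_ite, ite_mul, mul_one, mul_zero,
    zero_mul, Finset.sum_ite_irrel, Finset.sum_const_zero, Finset.sum_ite_eq, Finset.sum_ite_eq',
    Finset.mem_univ, if_true, add_sq, t1, ← Finset.mul_sum, ← Finset.sum_mul, hA]
  simp only [pow_two, mul_assoc, ← Finset.mul_sum, mul_comm (A _ q) _, mul_comm (A q _) (A p _), mul_comm (A q _) (A _ p)]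
  split_ifs
  · ring
  · ring

lemma Hten_sq_smul {n : ℕ} (W : Fin n → Fin n → Fin n → Fin n → ℝ) (r : ℝ) (p q : Fin n)
    (x : EuclideanSpace ℝ (Fin n)) :
    (∑ i, ∑ k, (Hten n W i k (r • x)) ^ 2) * (r • x) p * (r • x) q =
      ∑ i, ∑ k, ∑ a, ∑ b, ∑ c, ∑ d,
        r ^ 6 * (W i a k b * W i c k d) * mon [p, q, a, b, c, d] x := by
  simp only [Finset.sum_mul]
  refine Finset.sum_congr rfl fun i _ => Finset.sum_congr rfl fun k _ => ?_
  rw [Hten, pow_two]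
  simp only [Finset.sum_mul, Finset.mul_sum]
  have hsw : ∀ F : Fin n → Fin n → Fin n → Fin n → ℝ,
      ∑ c, ∑ d, ∑ a, ∑ b, F a b c d = ∑ a, ∑ b, ∑ c, ∑ d, F a b c d := by
    intro F
    calc _ = ∑ c, ∑ a, ∑ d, ∑ b, F a b c d :=
          Finset.sum_congr rfl fun c _ => Finset.sum_comm
      _ = ∑ a, ∑ c, ∑ d, ∑ b, F a b c d := Finset.sum_comm
      _ = ∑ a, ∑ c, ∑ b, ∑ d, F a b c d :=
          Finset.sum_congr rfl fun a _ => Finset.sum_congr rfl fun c _ => Finset.sum_comm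
      _ = _ := Finset.sum_congr rfl fun a _ => Finset.sum_comm
  refine Eq.trans ?_ (hsw _)
  refine Finset.sum_congr rfl fun c _ => Finset.sum_congr rfl fun d _ =>
    Finset.sum_congr rfl fun a _ => Finset.sum_congr rfl fun b _ => ?_
  simp only [mon_cons, mon_nil, PiLp.smul_apply, smul_eq_mul]
  ring

lemma mon_sphere_integrable {n : ℕ} (L : List (Fin n)) (c : ℝ) :
    Integrable (fun ω : Metric.sphere (0 : EuclideanSpace ℝ (Fin n)) 1 => c * mon L ω.1)
      (volume : Measure (EuclideanSpace ℝ (Fin n))).toSphere := by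
  have : Continuous (fun ω : Metric.sphere (0 : EuclideanSpace ℝ (Fin n)) 1 => c * mon L ω.1) :=
    continuous_const.mul ((mon_continuous L).comp continuous_subtype_val)
  exact this.integrable_of_hasCompactSupport (HasCompactSupport.of_compactSpace _)

theorem stmt_6 (n : ℕ) (hn : 3 ≤ n) (W : Fin n → Fin n → Fin n → Fin n → ℝ)
    (hsymm1 : ∀ i j k l, W i j k l = - W j i k l)
    (hsymm2 : ∀ i j k l, W i j k l = - W i j l k)
    (hsymm3 : ∀ i j k l, W i j k l = W k l i j)
    (hBianchi : ∀ i j k l, W i j k l + W i k l j + W i l j k = 0)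
    (htrace : ∀ j l, ∑ i, W i j i l = 0)
    (r : ℝ) (hr : 0 < r) (p q : Fin n) :
    ∫ x, (∑ i, ∑ k, (Hten n W i k x) ^ 2) * x p * x q ∂(surfMeasure n r)
      = 2 / ((n : ℝ) * ((n : ℝ) + 2) * ((n : ℝ) + 4)) * sphereArea n *
          (∑ i, ∑ k, ∑ l, (W i p k l + W i l k p) * (W i q k l + W i l k q)) * r ^ (n + 5)
        + 1 / (2 * (n : ℝ) * ((n : ℝ) + 2) * ((n : ℝ) + 4)) * sphereArea n *
          (∑ i, ∑ j, ∑ k, ∑ l, (W i j k l + W i l k j) ^ 2) *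
          (if p = q then 1 else 0) * r ^ (n + 5) := by
  have hint : ∫ x, (∑ i, ∑ k, (Hten n W i k x) ^ 2) * x p * x q ∂(surfMeasure n r)
      = r ^ (n - 1) * ∑ i, ∑ k, ∑ a, ∑ b, ∑ c, ∑ d, r ^ 6 * (W i a k b * W i c k d) *
        (wick p q a b c d * sphereArea n / ((n : ℝ) * ((n : ℝ) + 2) * ((n : ℝ) + 4))) := by
    rw [surfMeasure, integral_smul_measure, integral_map, ENNReal.toReal_ofReal (by positivity),
      smul_eq_mul]
    · congr 1
      simp only [Hten_sq_smul]
      have hI := fun L c => mon_sphere_integrable (n := n) L c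
      have step : ∀ (F : Fin n → Metric.sphere (0 : EuclideanSpace ℝ (Fin n)) 1 → ℝ) (v : Fin n → ℝ),
          (∀ a, Integrable (F a) (volume : Measure (EuclideanSpace ℝ (Fin n))).toSphere ∧
            ∫ ω, F a ω ∂(volume : Measure (EuclideanSpace ℝ (Fin n))).toSphere = v a) →
          Integrable (fun ω => ∑ a, F a ω) (volume : Measure (EuclideanSpace ℝ (Fin n))).toSphere ∧
            ∫ ω, ∑ a, F a ω ∂(volume : Measure (EuclideanSpace ℝ (Fin n))).toSphere = ∑ a, v a := by
        intro F v h
        refine ⟨integrable_finsetSum _ fun a _ => (h a).1, ?_⟩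
        rw [integral_finsetSum _ fun a _ => (h a).1]
        exact Finset.sum_congr rfl fun a _ => (h a).2
      refine (step _ _ fun i => step _ _ fun k => step _ _ fun a => step _ _ fun b =>
        step _ _ fun c => step _ _ fun d => ⟨hI _ _, ?_⟩).2
      rw [integral_const_mul, sphere_six hn]
    · fun_prop
    · refine Continuous.aestronglyMeasurable ?_
      unfold Hten
      fun_prop
  have hc : ∀ i k, ∑ a, ∑ b, ∑ c, ∑ d, r ^ 6 * (W i a k b * W i c k d) *
        (wick p q a b c d * sphereArea n / ((n : ℝ) * ((n : ℝ) + 2) * ((n : ℝ) + 4)))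
      = r ^ 6 * sphereArea n / ((n : ℝ) * ((n : ℝ) + 2) * ((n : ℝ) + 4)) *
        (1 / 2 * (∑ j, ∑ l, (W i j k l + W i l k j) ^ 2) * kd p q
          + 2 * ∑ l, (W i p k l + W i l k p) * (W i q k l + W i l k q)) := by
    intro i k
    rw [← contract (fun a b => W i a k b) ?_ p q]
    · simp only [Finset.mul_sum]
      refine Finset.sum_congr rfl fun a _ => Finset.sum_congr rfl fun b _ =>
        Finset.sum_congr rfl fun c _ => Finset.sum_congr rfl fun d _ => ?_
      ring
    · rw [← htrace i k]
      refine Finset.sum_congr rfl fun a _ => ?_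
      rw [hsymm1 i a k a, hsymm2 a i k a, neg_neg]
  rw [hint]
  simp only [hc]
  have hs : ∑ i, ∑ j, ∑ k, ∑ l, (W i j k l + W i l k j) ^ 2
      = ∑ i, ∑ k, ∑ j, ∑ l, (W i j k l + W i l k j) ^ 2 :=
    Finset.sum_congr rfl fun i _ => Finset.sum_comm
  rw [hs]
  simp only [← Finset.mul_sum, Finset.sum_add_distrib, ← Finset.sum_mul]
  have hp : r ^ (n + 5) = r ^ (n - 1) * r ^ 6 := by
    rw [← pow_add]; congr 1; omega
  have hk : kd p q = if p = q then 1 else 0 := rfl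
  have hn0 : (n : ℝ) ≠ 0 := by
    have : n ≠ 0 := by omega
    exact_mod_cast this
  rw [hp, hk]
  field_simp
  ring
end

section
/- For every r > 0 and all indices p, q ∈ {1,…,n}: ∫_{∂B_r(0)} Σ_{i,k,l=1}^n (∂_l H̄_{ik}(x))² x_p x_q dσ(x) = (2/(n(n+2)(n+4))) |S^{n−1}| Σ_{i,k,l=1}^n (W_{ipkl} + W_{ilkp})(W_{iqkl} + W_{ilkq}) · r^{n+3} [ (n+4) f(r²)² + 8 r² f(r²) f′(r²) + 4 r⁴ f′(r²)² ] + (1/(n(n+2)(n+4))) |S^{n−1}| Σ_{i,j,k,l=1}^n (W_{ijkl} + W_{ilkj})² δ_{pq} · r^{n+3} [ (n+4) f(r²)² + 4 r² f(r²) f′(r²) + 2 r⁴ f′(r²)² ]. -/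
open scoped BigOperators
open MeasureTheory

/-- The cut-off profile `f(s) = τ + 5s − s² + s³/20`. -/
noncomputable def fpoly (τ s : ℝ) : ℝ := τ + 5 * s - s ^ 2 + s ^ 3 / 20

/-- The modified tensor field `H̄_{ik}(x) = f(|x|²) H_{ik}(x)`. -/
noncomputable def Hbar (n : ℕ) (W : Fin n → Fin n → Fin n → Fin n → ℝ) (τ : ℝ)
    (i k : Fin n) (x : EuclideanSpace ℝ (Fin n)) : ℝ :=
  fpoly τ (‖x‖ ^ 2) * Hten n W i k x

namespace S8
open MvPolynomial

/-- evaluation of a polynomial at a Euclidean vector -/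
noncomputable def ev {n : ℕ} (P : MvPolynomial (Fin n) ℝ) (x : EuclideanSpace ℝ (Fin n)) : ℝ :=
  MvPolynomial.eval (fun i => x i) P

/-- Gaussian functional -/
noncomputable def G {n : ℕ} (P : MvPolynomial (Fin n) ℝ) : ℝ :=
  ∫ x : EuclideanSpace ℝ (Fin n), ev P x * Real.exp (-‖x‖ ^ 2)

/-- radial moments -/
noncomputable def K (m : ℕ) : ℝ := ∫ y in Set.Ioi (0 : ℝ), y ^ m * Real.exp (-y ^ 2)

lemma K_eq (m : ℕ) : K m = 1 / 2 * Real.Gamma (((m : ℝ) + 1) / 2) := by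
  have h := integral_rpow_mul_exp_neg_mul_rpow (p := 2) (q := m) (b := 1) two_pos
    (by have : (0 : ℝ) ≤ m := Nat.cast_nonneg m
        linarith) one_pos
  simp only [Real.one_rpow, one_mul] at h
  rw [← h, K]
  refine setIntegral_congr_fun measurableSet_Ioi (fun y _ => ?_)
  simp

lemma K_pos (m : ℕ) : 0 < K m := by
  rw [K_eq]
  have := Real.Gamma_pos_of_pos (s := ((m : ℝ) + 1) / 2) (by positivity)
  positivity

lemma K_add_two (m : ℕ) : K (m + 2) = ((m : ℝ) + 1) / 2 * K m := by
  rw [K_eq, K_eq]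
  have : (((m + 2 : ℕ) : ℝ) + 1) / 2 = ((m : ℝ) + 1) / 2 + 1 := by push_cast; ring
  rw [this, Real.Gamma_add_one (by positivity)]
  ring

lemma K_integrable (m : ℕ) :
    IntegrableOn (fun y : ℝ => y ^ m * Real.exp (-y ^ 2)) (Set.Ioi 0) := by
  have h := integrableOn_rpow_mul_exp_neg_mul_sq (b := 1) one_pos (s := m)
    (by have : (0 : ℝ) ≤ m := Nat.cast_nonneg m
        linarith)
  simpa using h

lemma ev_continuous {n : ℕ} (P : MvPolynomial (Fin n) ℝ) : Continuous (ev P) := by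
  unfold ev
  exact (MvPolynomial.continuous_eval P).comp (by fun_prop)

lemma integrable_aux {n : ℕ} [NeZero n] (P : MvPolynomial (Fin n) ℝ) : ∀ k : ℕ,
    Integrable (fun x : EuclideanSpace ℝ (Fin n) => ‖x‖ ^ k * ev P x * Real.exp (-‖x‖ ^ 2)) := by
  induction P using MvPolynomial.induction_on with
  | C a =>
    intro k
    have h : Integrable (fun x : EuclideanSpace ℝ (Fin n) => ‖x‖ ^ k * Real.exp (-‖x‖ ^ 2)) := by
      rw [integrable_fun_norm_addHaar volume (f := fun y => y ^ k * Real.exp (-y ^ 2))]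
      have := K_integrable (Module.finrank ℝ (EuclideanSpace ℝ (Fin n)) - 1 + k)
      simpa [pow_add, mul_assoc] using this
    refine (h.const_mul a).congr (.of_forall fun x => ?_)
    simp [ev]; ring
  | add P Q hP hQ =>
    intro k
    refine ((hP k).add (hQ k)).congr (.of_forall fun x => ?_)
    simp [ev]; ring
  | mul_X P i hP =>
    intro k
    refine (hP (k + 1)).mono ?_ (.of_forall fun x => ?_)
    · have := ev_continuous (P * X i)
      exact (by fun_prop : Continuous _).aestronglyMeasurable
    · have h1 : ‖x i‖ ≤ ‖x‖ := PiLp.norm_apply_le x i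
      have h2 : ev (P * X i) x = ev P x * x i := by simp [ev]
      rw [h2]
      rw [norm_mul, norm_mul, norm_mul, norm_mul, norm_mul, norm_pow, norm_pow, norm_norm]
      have : ‖x‖ ^ k * (‖ev P x‖ * ‖x i‖) ≤ ‖x‖ ^ (k + 1) * ‖ev P x‖ := by
        calc _ ≤ ‖x‖ ^ k * (‖ev P x‖ * ‖x‖) := by gcongr
          _ = _ := by ring
      exact mul_le_mul_of_nonneg_right this (norm_nonneg _)

lemma integrable_ev {n : ℕ} [NeZero n] (P : MvPolynomial (Fin n) ℝ) :
    Integrable (fun x : EuclideanSpace ℝ (Fin n) => ev P x * Real.exp (-‖x‖ ^ 2)) := by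
  simpa using integrable_aux P 0

lemma G_add {n : ℕ} [NeZero n] (P Q : MvPolynomial (Fin n) ℝ) : G (P + Q) = G P + G Q := by
  unfold G
  rw [← integral_add (integrable_ev P) (integrable_ev Q)]
  refine integral_congr_ae (.of_forall fun x => ?_)
  simp [ev]; ring

lemma G_C_mul {n : ℕ} (a : ℝ) (P : MvPolynomial (Fin n) ℝ) : G (C a * P) = a * G P := by
  unfold G
  rw [← integral_const_mul]
  refine integral_congr_ae (.of_forall fun x => ?_)
  simp [ev]; ring

/-- G as a linear map -/
noncomputable def GLin (n : ℕ) [NeZero n] : MvPolynomial (Fin n) ℝ →ₗ[ℝ] ℝ where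
  toFun := G
  map_add' := G_add
  map_smul' a P := by rw [MvPolynomial.smul_eq_C_mul, G_C_mul]; rfl

lemma ev_hasFDerivAt {n : ℕ} (P : MvPolynomial (Fin n) ℝ) (x : EuclideanSpace ℝ (Fin n)) :
    HasFDerivAt (ev P) (∑ i, ev (pderiv i P) x • (EuclideanSpace.proj i :
      EuclideanSpace ℝ (Fin n) →L[ℝ] ℝ)) x := by
  induction P using MvPolynomial.induction_on with
  | C a =>
    have : ev (C a : MvPolynomial (Fin n) ℝ) = fun _ => a := by ext; simp [ev]
    rw [this]
    refine (hasFDerivAt_const a x).congr_fderiv ?_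
    simp [ev]
  | add P Q hP hQ =>
    have : ev (P + Q) = ev P + ev Q := by ext; simp [ev]
    rw [this]
    refine (hP.add hQ).congr_fderiv ?_
    simp [ev, add_smul, Finset.sum_add_distrib]
  | mul_X P j hP =>
    have : ev (P * X j) = ev P * fun y => y j := by ext; simp [ev]
    rw [this]
    have hj : HasFDerivAt (fun y : EuclideanSpace ℝ (Fin n) => y j)
        (EuclideanSpace.proj j : EuclideanSpace ℝ (Fin n) →L[ℝ] ℝ) x :=
      (EuclideanSpace.proj j : EuclideanSpace ℝ (Fin n) →L[ℝ] ℝ).hasFDerivAt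
    refine (hP.mul hj).congr_fderiv ?_
    ext v
    simp [ev, Pi.single_apply, add_mul, Finset.sum_add_distrib, Finset.mul_sum, apply_ite,
      pderiv_X, mul_assoc]

lemma fderiv_ev {n : ℕ} (P : MvPolynomial (Fin n) ℝ) (x : EuclideanSpace ℝ (Fin n)) (i : Fin n) :
    fderiv ℝ (ev P) x (EuclideanSpace.single i 1) = ev (pderiv i P) x := by
  rw [(ev_hasFDerivAt P x).fderiv]
  simp

lemma stein {n : ℕ} [NeZero n] (i : Fin n) (P : MvPolynomial (Fin n) ℝ) :
    G (X i * P) = 1 / 2 * G (pderiv i P) := by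
  have hg : ∀ x : EuclideanSpace ℝ (Fin n), HasFDerivAt (fun x : EuclideanSpace ℝ (Fin n) =>
      Real.exp (-‖x‖ ^ 2)) (Real.exp (-‖x‖ ^ 2) • (-(2 • (innerSL ℝ x : EuclideanSpace ℝ (Fin n) →L[ℝ] ℝ)) :
        EuclideanSpace ℝ (Fin n) →L[ℝ] ℝ)) x := fun x =>
    ((hasStrictFDerivAt_norm_sq x).hasFDerivAt.neg).exp
  have hg' : ∀ x : EuclideanSpace ℝ (Fin n), fderiv ℝ (fun x : EuclideanSpace ℝ (Fin n) =>
      Real.exp (-‖x‖ ^ 2)) x (EuclideanSpace.single i 1) = -2 * (x i * Real.exp (-‖x‖ ^ 2)) := by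
    intro x
    rw [(hg x).fderiv]
    simp [EuclideanSpace.inner_single_right]
    ring
  have h := integral_mul_fderiv_eq_neg_fderiv_mul_of_integrable
    (μ := (volume : Measure (EuclideanSpace ℝ (Fin n))))
    (f := ev P) (g := fun x => Real.exp (-‖x‖ ^ 2)) (v := EuclideanSpace.single i 1)
    ?_ ?_ ?_ (fun x _ => (ev_hasFDerivAt P x).differentiableAt)
    (fun x _ => (hg x).differentiableAt)
  · simp only [hg', fderiv_ev] at h
    have h2 : ∫ x : EuclideanSpace ℝ (Fin n), ev P x * (-2 * (x i * Real.exp (-‖x‖ ^ 2)))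
        = -2 * G (X i * P) := by
      unfold G
      rw [← integral_const_mul]
      refine integral_congr_ae (.of_forall fun x => ?_)
      simp [ev]; ring
    rw [h2] at h
    change _ = - G (pderiv i P) at h
    linarith
  · simp only [fderiv_ev]; exact integrable_ev _
  · simp only [hg']
    refine ((integrable_ev (X i * P)).const_mul (-2)).congr (.of_forall fun x => ?_)
    simp [ev]; ring
  · exact integrable_ev _

lemma polar {n : ℕ} [NeZero n] (P : MvPolynomial (Fin n) ℝ) (d : ℕ)
    (hP : ∀ (r : ℝ) (x : EuclideanSpace ℝ (Fin n)), ev P (r • x) = r ^ d * ev P x) :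
    G P = (∫ ω : Metric.sphere (0 : EuclideanSpace ℝ (Fin n)) 1, ev P (ω : EuclideanSpace ℝ (Fin n))
      ∂(volume : Measure (EuclideanSpace ℝ (Fin n))).toSphere) * K (n - 1 + d) := by
  set E := EuclideanSpace ℝ (Fin n)
  set μ := (volume : Measure E)
  let F : Metric.sphere (0 : E) 1 × Set.Ioi (0 : ℝ) → ℝ := fun z =>
    ev P (z.1 : E) * ((z.2 : ℝ) ^ d * Real.exp (-(z.2 : ℝ) ^ 2))
  calc
    G P = ∫ x : ({(0)}ᶜ : Set E), ev P (x : E) * Real.exp (-‖(x : E)‖ ^ 2) ∂(μ.comap (↑)) := by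
      rw [integral_subtype_comap (measurableSet_singleton _).compl
        fun x : E ↦ ev P (x : E) * Real.exp (-‖(x : E)‖ ^ 2),
        restrict_compl_singleton]
      rfl
    _ = ∫ x : ({(0)}ᶜ : Set E), F (homeomorphUnitSphereProd E x) ∂(μ.comap (↑)) := by
      refine integral_congr_ae (.of_forall fun x => ?_)
      have hx : ‖(x : E)‖ ≠ 0 := norm_ne_zero_iff.2 x.2
      have : (x : E) = ‖(x : E)‖ • (‖(x : E)‖⁻¹ • (x : E)) := by
        rw [smul_smul, mul_inv_cancel₀ hx, one_smul]
      have h3 : ev P (x : E) = ‖(x : E)‖ ^ d * ev P (‖(x : E)‖⁻¹ • (x : E)) := by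
        rw [← hP, ← this]
      simp only [F, homeomorphUnitSphereProd_apply_snd_coe, homeomorphUnitSphereProd_apply_fst_coe]
      rw [h3]; ring
    _ = ∫ z, F z ∂μ.toSphere.prod (.volumeIoiPow (Module.finrank ℝ E - 1)) :=
      μ.measurePreserving_homeomorphUnitSphereProd.integral_comp
        (Homeomorph.measurableEmbedding _) F
    _ = (∫ ω, ev P (ω : E) ∂μ.toSphere) * ∫ x : Set.Ioi (0 : ℝ),
          ((x : ℝ) ^ d * Real.exp (-(x : ℝ) ^ 2)) ∂.volumeIoiPow (Module.finrank ℝ E - 1) :=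
      integral_prod_mul (fun ω : Metric.sphere (0 : E) 1 => ev P (ω : E))
        (fun x : Set.Ioi (0 : ℝ) => (x : ℝ) ^ d * Real.exp (-(x : ℝ) ^ 2))
    _ = _ := by
      congr 1
      simp only [Measure.volumeIoiPow, ENNReal.ofReal]
      rw [integral_withDensity_eq_integral_smul,
        integral_subtype_comap measurableSet_Ioi fun a : ℝ ↦
          Real.toNNReal (a ^ (Module.finrank ℝ E - 1)) • (a ^ d * Real.exp (-a ^ 2)), K,
        setIntegral_congr_fun measurableSet_Ioi fun x hx ↦ ?_]
      · simp only [E, finrank_euclideanSpace, Fintype.card_fin]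
        rw [NNReal.smul_def, Real.coe_toNNReal _ (pow_nonneg hx.out.le _), pow_add, smul_eq_mul]
        ring
      · exact (measurable_subtype_coe.pow_const _).real_toNNReal

lemma G_sum {n : ℕ} [NeZero n] {ι : Type*} (s : Finset ι) (P : ι → MvPolynomial (Fin n) ℝ) :
    G (∑ i ∈ s, P i) = ∑ i ∈ s, G (P i) := map_sum (GLin n) P s

/-- linear form -/
noncomputable def Lf {n : ℕ} (A : Fin n → Fin n → ℝ) (j : Fin n) : MvPolynomial (Fin n) ℝ :=
  ∑ l, C (A j l) * X l

/-- quadratic form -/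
noncomputable def Qf {n : ℕ} (A : Fin n → Fin n → ℝ) : MvPolynomial (Fin n) ℝ :=
  ∑ j, X j * Lf A j

lemma pderiv_Lf {n : ℕ} (A : Fin n → Fin n → ℝ) (j a : Fin n) :
    pderiv a (Lf A j) = C (A j a) := by
  simp [Lf, pderiv_X, Pi.single_apply]

lemma pderiv_Qf {n : ℕ} (A : Fin n → Fin n → ℝ) (hA : ∀ j l, A j l = A l j) (a : Fin n) :
    pderiv a (Qf A) = C 2 * Lf A a := by
  have : pderiv a (Qf A) = ∑ j, (X j * C (A j a) + (if a = j then 1 else 0) * Lf A j) := by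
    rw [Qf, map_sum]
    refine Finset.sum_congr rfl fun j _ => ?_
    rw [Derivation.leibniz, pderiv_Lf, pderiv_X, Pi.single_apply, smul_eq_mul, smul_eq_mul]
    by_cases h : j = a <;> simp [h, eq_comm]
    all_goals ring_nf
    try simp [Ne.symm h]
  rw [this, Finset.sum_add_distrib]
  have h1 : ∑ j, X j * C (A j a) = Lf A a := by
    rw [Lf]
    exact Finset.sum_congr rfl fun j _ => by rw [hA j a, mul_comm]
  have h2 : (C 2 : MvPolynomial (Fin n) ℝ) = 2 := map_ofNat C 2
  rw [h1, h2]
  simp [two_mul]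

set_option linter.unusedSectionVars false
section
variable {n : ℕ} [NeZero n] (A : Fin n → Fin n → ℝ)

lemma G_C (a : ℝ) : G (C a : MvPolynomial (Fin n) ℝ) = a * G (1 : MvPolynomial (Fin n) ℝ) := by
  rw [← G_C_mul, mul_one]

lemma G_Lf_mul (j : Fin n) (P : MvPolynomial (Fin n) ℝ) :
    G (Lf A j * P) = 1 / 2 * ∑ l, A j l * G (pderiv l P) := by
  rw [Lf, Finset.sum_mul, G_sum, Finset.mul_sum]
  refine Finset.sum_congr rfl fun l _ => ?_
  rw [mul_assoc, G_C_mul, stein]; ring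

lemma G_LL (p q : Fin n) :
    G (Lf A p * Lf A q) = 1 / 2 * (∑ l, A p l * A q l) * G (1 : MvPolynomial (Fin n) ℝ) := by
  rw [G_Lf_mul]
  simp only [pderiv_Lf, G_C, Finset.mul_sum, Finset.sum_mul]
  refine Finset.sum_congr rfl fun l _ => by ring

lemma G_Q (hT : ∑ j, A j j = 0) : G (Qf A) = 0 := by
  rw [Qf, G_sum]
  simp only [stein, pderiv_Lf, G_C]
  rw [← Finset.mul_sum, ← Finset.sum_mul, hT]; ring

lemma G_QQ (hA : ∀ j l, A j l = A l j) (hT : ∑ j, A j j = 0) : G (Qf A * Qf A) = 1 / 2 * (∑ j, ∑ l, A j l ^ 2) * G (1 : MvPolynomial (Fin n) ℝ) := by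
  nth_rw 1 [Qf]
  rw [Finset.sum_mul, G_sum]
  have : ∀ j, G (X j * Lf A j * Qf A) = 1 / 2 * (∑ l, A j l ^ 2) * G (1 : MvPolynomial (Fin n) ℝ)
      + 1 / 2 * A j j * G (Qf A) := by
    intro j
    rw [mul_assoc, stein, Derivation.leibniz, pderiv_Lf, pderiv_Qf A hA, smul_eq_mul, smul_eq_mul,
      mul_left_comm, mul_comm (Qf A), G_add, G_C_mul, G_C_mul, G_LL]
    simp only [← pow_two]
    ring
  simp only [this, G_Q A hT, mul_zero, add_zero]
  rw [← Finset.sum_mul, ← Finset.mul_sum]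

lemma G_XX (p q : Fin n) (P : MvPolynomial (Fin n) ℝ) :
    G (X p * (X q * P)) = 1 / 2 * ((if p = q then 1 else 0) * G P + G (X q * pderiv p P)) := by
  rw [stein, Derivation.leibniz, pderiv_X, Pi.single_apply, G_add, smul_eq_mul, smul_eq_mul]
  by_cases h : p = q
  · subst h; simp; ring
  · rw [if_neg (Ne.symm h)]
    simp [h]
    simp [G, ev]

lemma G_XXQQ (hA : ∀ j l, A j l = A l j) (hT : ∑ j, A j j = 0) (p q : Fin n) : G (X p * (X q * (Qf A * Qf A))) =
    (1 / 4 * (∑ j, ∑ l, A j l ^ 2) * (if p = q then 1 else 0) + ∑ l, A p l * A q l) *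
      G (1 : MvPolynomial (Fin n) ℝ) := by
  rw [G_XX, G_QQ A hA hT, Derivation.leibniz, pderiv_Qf A hA, smul_eq_mul]
  have h1 : X q * (Qf A * (C 2 * Lf A p) + Qf A * (C 2 * Lf A p))
      = C 4 * (X q * (Qf A * Lf A p)) := by
    have : (C 4 : MvPolynomial (Fin n) ℝ) = C 2 + C 2 := by rw [← C_add]; norm_num
    rw [this]; ring
  rw [h1, G_C_mul, stein, Derivation.leibniz, pderiv_Qf A hA, pderiv_Lf, smul_eq_mul, smul_eq_mul,
    mul_left_comm (Lf A p), mul_comm (Qf A), G_add, G_C_mul, G_C_mul, G_Q A hT, G_LL]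
  ring

lemma G_XXLL (hA : ∀ j l, A j l = A l j) (p q : Fin n) : G (X p * (X q * ∑ l, Lf A l * Lf A l)) =
    (1 / 4 * (∑ j, ∑ l, A j l ^ 2) * (if p = q then 1 else 0) + 1 / 2 * ∑ l, A p l * A q l) *
      G (1 : MvPolynomial (Fin n) ℝ) := by
  rw [G_XX]
  have h0 : X q * pderiv p (∑ l, Lf A l * Lf A l) = ∑ l, C (2 * A p l) * (X q * Lf A l) := by
    rw [map_sum, Finset.mul_sum]
    refine Finset.sum_congr rfl fun l _ => ?_
    rw [Derivation.leibniz, pderiv_Lf, hA p l, smul_eq_mul, C_mul]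
    have : (C 2 : MvPolynomial (Fin n) ℝ) = 2 := map_ofNat C 2
    rw [this]; ring
  rw [h0, G_sum, G_sum]
  simp only [G_C_mul, stein, pderiv_Lf, G_C, G_LL]
  have e1 : ∑ l, 2 * A p l * (1 / 2 * (A l q * G (1 : MvPolynomial (Fin n) ℝ))) =
      (∑ l, A p l * A q l) * G (1 : MvPolynomial (Fin n) ℝ) := by
    rw [Finset.sum_mul]
    exact Finset.sum_congr rfl fun l _ => by rw [hA l q]; ring
  have e2 : ∑ j, 1 / 2 * (∑ l, A j l * A j l) * G (1 : MvPolynomial (Fin n) ℝ) =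
      1 / 2 * (∑ j, ∑ l, A j l ^ 2) * G (1 : MvPolynomial (Fin n) ℝ) := by
    simp only [← pow_two]
    rw [← Finset.sum_mul, ← Finset.mul_sum]
  rw [e1, e2]
  ring

lemma G_one : G (1 : MvPolynomial (Fin n) ℝ) = sphereArea n * K (n - 1) := by
  rw [polar 1 0 (by simp [ev])]
  simp [ev, sphereArea, Measure.real]

lemma ev_Lf (j : Fin n) (x : EuclideanSpace ℝ (Fin n)) : ev (Lf A j) x = ∑ l, A j l * x l := by
  simp [ev, Lf]

lemma ev_Qf (x : EuclideanSpace ℝ (Fin n)) :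
    ev (Qf A) x = ∑ j, x j * ∑ l, A j l * x l := by
  simp [ev, Qf, Lf]

lemma ev_mul (P Q : MvPolynomial (Fin n) ℝ) (x : EuclideanSpace ℝ (Fin n)) :
    ev (P * Q) x = ev P x * ev Q x := by simp [ev]

lemma ev_sum {ι : Type*} (s : Finset ι) (P : ι → MvPolynomial (Fin n) ℝ)
    (x : EuclideanSpace ℝ (Fin n)) :
    ev (∑ i ∈ s, P i) x = ∑ i ∈ s, ev (P i) x := by simp [ev]

lemma ev_X (i : Fin n) (x : EuclideanSpace ℝ (Fin n)) : ev (X i) x = x i := by simp [ev]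

lemma ev_Lf_smul (j : Fin n) (r : ℝ) (x : EuclideanSpace ℝ (Fin n)) :
    ev (Lf A j) (r • x) = r * ev (Lf A j) x := by
  simp only [ev_Lf, Finset.mul_sum, PiLp.smul_apply, smul_eq_mul]
  exact Finset.sum_congr rfl fun l _ => by ring

lemma ev_Qf_smul (r : ℝ) (x : EuclideanSpace ℝ (Fin n)) :
    ev (Qf A) (r • x) = r ^ 2 * ev (Qf A) x := by
  simp only [Qf, ev_sum, ev_mul, ev_X, ev_Lf_smul, Finset.mul_sum, PiLp.smul_apply, smul_eq_mul]
  exact Finset.sum_congr rfl fun l _ => by ring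

lemma n_pred : ((n - 1 : ℕ) : ℝ) = n - 1 := by
  rw [Nat.cast_pred (Nat.pos_of_neZero n)]

lemma sphere_LL (hA : ∀ j l, A j l = A l j) (p q : Fin n) :
    ∫ ω : Metric.sphere (0 : EuclideanSpace ℝ (Fin n)) 1,
      ev (X p * (X q * ∑ l, Lf A l * Lf A l)) (ω : EuclideanSpace ℝ (Fin n))
      ∂(volume : Measure (EuclideanSpace ℝ (Fin n))).toSphere
    = sphereArea n / ((n : ℝ) * (n + 2)) *
      ((∑ j, ∑ l, A j l ^ 2) * (if p = q then 1 else 0) + 2 * ∑ l, A p l * A q l) := by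
  have h := polar (X p * (X q * ∑ l, Lf A l * Lf A l)) 4 (by
    intro r x
    simp only [ev_sum, ev_mul, ev_X, ev_Lf_smul, Finset.mul_sum, PiLp.smul_apply, smul_eq_mul]
    exact Finset.sum_congr rfl fun l _ => by ring)
  rw [G_XXLL A hA, G_one, show n - 1 + 4 = n - 1 + 2 + 2 from rfl, K_add_two, K_add_two] at h
  push_cast [n_pred (n := n)] at h
  have hK := K_pos (n - 1)
  have hn : (0 : ℝ) < n := by exact_mod_cast Nat.pos_of_neZero n
  generalize (∫ ω : Metric.sphere (0 : EuclideanSpace ℝ (Fin n)) 1,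
      ev (X p * (X q * ∑ l, Lf A l * Lf A l)) (ω : EuclideanSpace ℝ (Fin n))
      ∂(volume : Measure (EuclideanSpace ℝ (Fin n))).toSphere) = I at *
  rw [div_mul_eq_mul_div, eq_div_iff (by positivity)]
  apply mul_right_cancel₀ hK.ne'
  linear_combination (-4) * h

lemma sphere_QQ (hA : ∀ j l, A j l = A l j) (hT : ∑ j, A j j = 0) (p q : Fin n) :
    ∫ ω : Metric.sphere (0 : EuclideanSpace ℝ (Fin n)) 1,
      ev (X p * (X q * (Qf A * Qf A))) (ω : EuclideanSpace ℝ (Fin n))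
      ∂(volume : Measure (EuclideanSpace ℝ (Fin n))).toSphere
    = sphereArea n / ((n : ℝ) * (n + 2) * (n + 4)) *
      (2 * (∑ j, ∑ l, A j l ^ 2) * (if p = q then 1 else 0) + 8 * ∑ l, A p l * A q l) := by
  have h := polar (X p * (X q * (Qf A * Qf A))) 6 (by
    intro r x
    simp only [ev_mul, ev_X, ev_Qf_smul, PiLp.smul_apply, smul_eq_mul]
    ring)
  rw [G_XXQQ A hA hT, G_one, show n - 1 + 6 = n - 1 + 2 + 2 + 2 from rfl, K_add_two, K_add_two,
    K_add_two] at h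
  push_cast [n_pred (n := n)] at h
  have hK := K_pos (n - 1)
  have hn : (0 : ℝ) < n := by exact_mod_cast Nat.pos_of_neZero n
  generalize (∫ ω : Metric.sphere (0 : EuclideanSpace ℝ (Fin n)) 1,
      ev (X p * (X q * (Qf A * Qf A))) (ω : EuclideanSpace ℝ (Fin n))
      ∂(volume : Measure (EuclideanSpace ℝ (Fin n))).toSphere) = I at *
  rw [div_mul_eq_mul_div, eq_div_iff (by positivity)]
  apply mul_right_cancel₀ hK.ne'
  linear_combination (-8) * h

end

lemma integrable_sphere {n : ℕ} (P : MvPolynomial (Fin n) ℝ) :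
    Integrable (fun ω : Metric.sphere (0 : EuclideanSpace ℝ (Fin n)) 1 =>
      ev P (ω : EuclideanSpace ℝ (Fin n)))
      (volume : Measure (EuclideanSpace ℝ (Fin n))).toSphere :=
  ((ev_continuous P).comp continuous_subtype_val).integrable_of_hasCompactSupport
    (HasCompactSupport.of_compactSpace _)


/-- symmetrised coefficient matrix -/
def Am {n : ℕ} (W : Fin n → Fin n → Fin n → Fin n → ℝ) (i k j l : Fin n) : ℝ :=
  W i j k l + W i l k j

lemma Hten_eq {n : ℕ} [NeZero n] (W : Fin n → Fin n → Fin n → Fin n → ℝ) (i k : Fin n) :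
    Hten n W i k = ev (C (1 / 2) * Qf (Am W i k)) := by
  ext x
  rw [ev_mul, ev_Qf]
  have h0 : ev (C (1 / 2) : MvPolynomial (Fin n) ℝ) x = 1 / 2 := by simp [ev]
  have h1 : ∑ j, x j * ∑ l, Am W i k j l * x l
      = Hten n W i k x + ∑ j, ∑ l, W i l k j * x l * x j := by
    rw [Hten, ← Finset.sum_add_distrib]
    refine Finset.sum_congr rfl fun j _ => ?_
    rw [← Finset.sum_add_distrib, Finset.mul_sum]
    exact Finset.sum_congr rfl fun l _ => by rw [Am]; ring
  rw [h0, h1, Finset.sum_comm, Hten]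
  ring

lemma fpoly_differentiable (τ : ℝ) : Differentiable ℝ (fpoly τ) := by
  unfold fpoly
  fun_prop

lemma pder_Hbar {n : ℕ} [NeZero n] (W : Fin n → Fin n → Fin n → Fin n → ℝ) (τ : ℝ)
    (i k l : Fin n) (x : EuclideanSpace ℝ (Fin n)) :
    pder n l (Hbar n W τ i k) x = deriv (fpoly τ) (‖x‖ ^ 2) * x l * ev (Qf (Am W i k)) x
      + fpoly τ (‖x‖ ^ 2) * ev (Lf (Am W i k) l) x := by
  have hf : HasFDerivAt (fun y : EuclideanSpace ℝ (Fin n) => fpoly τ (‖y‖ ^ 2))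
      (deriv (fpoly τ) (‖x‖ ^ 2) • (2 • (innerSL ℝ x : EuclideanSpace ℝ (Fin n) →L[ℝ] ℝ) :
        EuclideanSpace ℝ (Fin n) →L[ℝ] ℝ)) x :=
    HasDerivAt.comp_hasFDerivAt (h₂ := fpoly τ) x ((fpoly_differentiable τ) (‖x‖ ^ 2)).hasDerivAt
      (hasStrictFDerivAt_norm_sq x).hasFDerivAt
  have hH := ev_hasFDerivAt (C (1 / 2) * Qf (Am W i k)) x
  have hHd := fderiv_ev (C (1 / 2) * Qf (Am W i k)) x l
  rw [hH.fderiv] at hHd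
  have hB : Hbar n W τ i k = (fun y => fpoly τ (‖y‖ ^ 2)) * ev (C (1 / 2) * Qf (Am W i k)) := by
    ext y; rw [Hbar, Hten_eq]; rfl
  have hsym : ∀ j l, Am W i k j l = Am W i k l j := fun j l => by simp only [Am]; ring
  rw [pder, hB, (hf.mul hH).fderiv, add_apply, smul_apply, hHd]
  have e1 : pderiv l (C (1 / 2) * Qf (Am W i k)) = Lf (Am W i k) l := by
    rw [Derivation.leibniz, pderiv_Qf _ hsym, pderiv_C, smul_zero, add_zero, smul_eq_mul,
      ← mul_assoc, ← C_mul]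
    norm_num
  have h0 : ev (C (1 / 2) : MvPolynomial (Fin n) ℝ) x = 1 / 2 := by simp [ev]
  rw [e1, ev_mul, h0]
  simp [EuclideanSpace.inner_single_right]
  ring

lemma sum_pder_sq {n : ℕ} [NeZero n] (W : Fin n → Fin n → Fin n → Fin n → ℝ) (τ : ℝ)
    (i k : Fin n) (x : EuclideanSpace ℝ (Fin n)) :
    ∑ l, (pder n l (Hbar n W τ i k) x) ^ 2
      = (deriv (fpoly τ) (‖x‖ ^ 2) ^ 2 * ‖x‖ ^ 2
          + 2 * fpoly τ (‖x‖ ^ 2) * deriv (fpoly τ) (‖x‖ ^ 2)) *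
          ev (Qf (Am W i k) * Qf (Am W i k)) x
        + fpoly τ (‖x‖ ^ 2) ^ 2 * ev (∑ l, Lf (Am W i k) l * Lf (Am W i k) l) x := by
  set F := fpoly τ (‖x‖ ^ 2) with hF
  set D := deriv (fpoly τ) (‖x‖ ^ 2) with hD
  set Q := ev (Qf (Am W i k)) x with hQ
  have e : ∀ l, (pder n l (Hbar n W τ i k) x) ^ 2 = D ^ 2 * Q ^ 2 * x l ^ 2
      + 2 * F * D * Q * (x l * ev (Lf (Am W i k) l) x)
      + F ^ 2 * (ev (Lf (Am W i k) l) x * ev (Lf (Am W i k) l) x) := by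
    intro l
    rw [pder_Hbar]; ring
  simp only [e, Finset.sum_add_distrib, ← Finset.mul_sum]
  have h1 : ∑ l, x l ^ 2 = ‖x‖ ^ 2 := by
    rw [EuclideanSpace.norm_sq_eq]; simp
  have h2 : ∑ l, x l * ev (Lf (Am W i k) l) x = Q := by
    rw [hQ, Qf, ev_sum]; simp only [ev_mul, ev_X]
  rw [h1, h2, ev_sum, ev_mul]
  simp only [ev_mul]
  ring

end S8

theorem stmt_8 (n : ℕ) (hn : 3 ≤ n) (W : Fin n → Fin n → Fin n → Fin n → ℝ)
    (hsymm1 : ∀ i j k l, W i j k l = - W j i k l)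
    (hsymm2 : ∀ i j k l, W i j k l = - W i j l k)
    (hsymm3 : ∀ i j k l, W i j k l = W k l i j)
    (hBianchi : ∀ i j k l, W i j k l + W i k l j + W i l j k = 0)
    (htrace : ∀ j l, ∑ i, W i j i l = 0)
    (τ : ℝ) (r : ℝ) (hr : 0 < r) (p q : Fin n) :
    ∫ x, (∑ i, ∑ k, ∑ l, (pder n l (Hbar n W τ i k) x) ^ 2) * x p * x q
        ∂(surfMeasure n r)
      = 2 / ((n : ℝ) * ((n : ℝ) + 2) * ((n : ℝ) + 4)) * sphereArea n *
          (∑ i, ∑ k, ∑ l, (W i p k l + W i l k p) * (W i q k l + W i l k q)) *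
          (r ^ (n + 3) *
            (((n : ℝ) + 4) * fpoly τ (r ^ 2) ^ 2
              + 8 * r ^ 2 * fpoly τ (r ^ 2) * deriv (fpoly τ) (r ^ 2)
              + 4 * r ^ 4 * (deriv (fpoly τ) (r ^ 2)) ^ 2))
        + 1 / ((n : ℝ) * ((n : ℝ) + 2) * ((n : ℝ) + 4)) * sphereArea n *
          (∑ i, ∑ j, ∑ k, ∑ l, (W i j k l + W i l k j) ^ 2) *
          (if p = q then 1 else 0) *
          (r ^ (n + 3) *
            (((n : ℝ) + 4) * fpoly τ (r ^ 2) ^ 2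
              + 4 * r ^ 2 * fpoly τ (r ^ 2) * deriv (fpoly τ) (r ^ 2)
              + 2 * r ^ 4 * (deriv (fpoly τ) (r ^ 2)) ^ 2)) := by
  have : NeZero n := ⟨by omega⟩
  set c1 : ℝ := (deriv (fpoly τ) (r ^ 2) ^ 2 * r ^ 2
      + 2 * fpoly τ (r ^ 2) * deriv (fpoly τ) (r ^ 2)) * r ^ 6 with hc1
  set c2 : ℝ := fpoly τ (r ^ 2) ^ 2 * r ^ 4 with hc2
  have hsym : ∀ i k j l, S8.Am W i k j l = S8.Am W i k l j := fun i k j l => by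
    simp only [S8.Am]; ring
  have htr : ∀ i k, ∑ j, S8.Am W i k j j = 0 := by
    intro i k
    have : ∀ j, S8.Am W i k j j = 2 * W j i j k := by
      intro j
      rw [S8.Am, hsymm1 i j k j, hsymm2 j i k j]; ring
    simp only [this]
    rw [← Finset.mul_sum, htrace, mul_zero]
  have hcont : Continuous (fun ω : Metric.sphere (0 : EuclideanSpace ℝ (Fin n)) 1 =>
        r • (ω : EuclideanSpace ℝ (Fin n))) := by fun_prop
  have hinj : Function.Injective (fun ω : Metric.sphere (0 : EuclideanSpace ℝ (Fin n)) 1 =>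
        r • (ω : EuclideanSpace ℝ (Fin n))) := by
    intro a b hab
    exact Subtype.ext (smul_right_injective _ hr.ne' hab)
  have hemb : MeasurableEmbedding (fun ω : Metric.sphere (0 : EuclideanSpace ℝ (Fin n)) 1 =>
        r • (ω : EuclideanSpace ℝ (Fin n))) :=
    (hcont.isClosedEmbedding hinj).measurableEmbedding
  rw [surfMeasure, integral_smul_measure, hemb.integral_map,
    ENNReal.toReal_ofReal (by positivity)]
  have hint : ∀ ω : Metric.sphere (0 : EuclideanSpace ℝ (Fin n)) 1,
      (∑ i, ∑ k, ∑ l, (pder n l (Hbar n W τ i k) (r • (ω : EuclideanSpace ℝ (Fin n)))) ^ 2) *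
        (r • (ω : EuclideanSpace ℝ (Fin n))) p * (r • (ω : EuclideanSpace ℝ (Fin n))) q
      = ∑ i, ∑ k, (c1 * S8.ev (MvPolynomial.X p * (MvPolynomial.X q *
            (S8.Qf (S8.Am W i k) * S8.Qf (S8.Am W i k)))) (ω : EuclideanSpace ℝ (Fin n))
          + c2 * S8.ev (MvPolynomial.X p * (MvPolynomial.X q *
            ∑ l, S8.Lf (S8.Am W i k) l * S8.Lf (S8.Am W i k) l))
              (ω : EuclideanSpace ℝ (Fin n))) := by
    intro ω
    have hω : ‖r • (ω : EuclideanSpace ℝ (Fin n))‖ = r := by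
      rw [norm_smul, norm_eq_of_mem_sphere, Real.norm_of_nonneg hr.le, mul_one]
    simp only [S8.sum_pder_sq, hω, Finset.sum_mul]
    refine Finset.sum_congr rfl fun i _ => Finset.sum_congr rfl fun k _ => ?_
    have e1 : S8.ev (∑ l, S8.Lf (S8.Am W i k) l * S8.Lf (S8.Am W i k) l)
        (r • (ω : EuclideanSpace ℝ (Fin n))) = r ^ 2 *
        S8.ev (∑ l, S8.Lf (S8.Am W i k) l * S8.Lf (S8.Am W i k) l)
        (ω : EuclideanSpace ℝ (Fin n)) := by
      rw [S8.ev_sum, S8.ev_sum, Finset.mul_sum]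
      refine Finset.sum_congr rfl fun l _ => ?_
      rw [S8.ev_mul, S8.ev_mul, S8.ev_Lf_smul]; ring
    rw [e1]
    simp only [S8.ev_mul, S8.ev_X, S8.ev_Qf_smul, PiLp.smul_apply, smul_eq_mul]
    rw [hc1, hc2]
    ring
  simp only [hint]
  have hI1 := fun i k => (S8.integrable_sphere (MvPolynomial.X p * (MvPolynomial.X q *
            (S8.Qf (S8.Am W i k) * S8.Qf (S8.Am W i k))))).const_mul c1
  have hI2 := fun i k => (S8.integrable_sphere (MvPolynomial.X p * (MvPolynomial.X q *
            ∑ l, S8.Lf (S8.Am W i k) l * S8.Lf (S8.Am W i k) l))).const_mul c2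
  have hI3 : ∀ i k, Integrable (fun ω : Metric.sphere (0 : EuclideanSpace ℝ (Fin n)) 1 =>
      (c1 * S8.ev (MvPolynomial.X p * (MvPolynomial.X q *
            (S8.Qf (S8.Am W i k) * S8.Qf (S8.Am W i k)))) (ω : EuclideanSpace ℝ (Fin n))
          + c2 * S8.ev (MvPolynomial.X p * (MvPolynomial.X q *
            ∑ l, S8.Lf (S8.Am W i k) l * S8.Lf (S8.Am W i k) l))
              (ω : EuclideanSpace ℝ (Fin n))))
      (volume : Measure (EuclideanSpace ℝ (Fin n))).toSphere :=
    fun i k => (hI1 i k).add (hI2 i k)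
  rw [integral_finsetSum _ (fun i _ => integrable_finsetSum _ fun k _ => hI3 i k)]
  have hk : ∀ i, ∫ ω : Metric.sphere (0 : EuclideanSpace ℝ (Fin n)) 1,
        ∑ k, (c1 * S8.ev (MvPolynomial.X p * (MvPolynomial.X q *
            (S8.Qf (S8.Am W i k) * S8.Qf (S8.Am W i k)))) (ω : EuclideanSpace ℝ (Fin n))
          + c2 * S8.ev (MvPolynomial.X p * (MvPolynomial.X q *
            ∑ l, S8.Lf (S8.Am W i k) l * S8.Lf (S8.Am W i k) l))
              (ω : EuclideanSpace ℝ (Fin n)))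
        ∂(volume : Measure (EuclideanSpace ℝ (Fin n))).toSphere
      = ∑ k, ((c1 * (sphereArea n / ((n : ℝ) * (n + 2) * (n + 4))) * 2 +
            c2 * (sphereArea n / ((n : ℝ) * (n + 2)))) * (if p = q then 1 else 0) *
            (∑ j, ∑ l, S8.Am W i k j l ^ 2)
          + (c1 * (sphereArea n / ((n : ℝ) * (n + 2) * (n + 4))) * 8 +
            c2 * (sphereArea n / ((n : ℝ) * (n + 2))) * 2) *
            ∑ l, S8.Am W i k p l * S8.Am W i k q l) := by
    intro i
    rw [integral_finsetSum _ (fun k _ => hI3 i k)]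
    refine Finset.sum_congr rfl fun k _ => ?_
    rw [integral_add (hI1 i k) (hI2 i k), integral_const_mul, integral_const_mul,
      S8.sphere_QQ _ (hsym i k) (htr i k), S8.sphere_LL _ (hsym i k)]
    ring
  rw [Finset.sum_congr rfl fun i _ => hk i]
  simp only [Finset.sum_add_distrib, ← Finset.mul_sum]
  have hS : ∑ i, ∑ j, ∑ k, ∑ l, (W i j k l + W i l k j) ^ 2
      = ∑ i, ∑ k, ∑ j, ∑ l, S8.Am W i k j l ^ 2 := by
    refine Finset.sum_congr rfl fun i _ => ?_
    rw [Finset.sum_comm]; rfl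
  have hP : ∑ i, ∑ k, ∑ l, (W i p k l + W i l k p) * (W i q k l + W i l k q)
      = ∑ i, ∑ k, ∑ l, S8.Am W i k p l * S8.Am W i k q l := rfl
  rw [hS, hP]
  generalize (∑ i, ∑ k, ∑ j, ∑ l, S8.Am W i k j l ^ 2) = S
  generalize (∑ i, ∑ k, ∑ l, S8.Am W i k p l * S8.Am W i k q l) = T
  generalize (if p = q then (1 : ℝ) else 0) = δ
  have hr' : r ^ (n + 3) = r ^ (n - 1) * r ^ 4 := by
    rw [← pow_add]; congr 1; omega
  have hn0 : (n : ℝ) ≠ 0 := NeZero.ne _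
  have hn2 : (n : ℝ) + 2 ≠ 0 := by positivity
  have hn4 : (n : ℝ) + 4 ≠ 0 := by positivity
  rw [hr', hc1, hc2, smul_eq_mul]
  field_simp
  ring
end

section
/- For every r > 0: ∫_{∂B_r(0)} Σ_{i,k,l=1}^n (∂_l H̄_{ik}(x))² dσ(x) = (1/(n(n+2))) |S^{n−1}| Σ_{i,j,k,l=1}^n (W_{ijkl} + W_{ilkj})² · r^{n+1} [ (n+2) f(r²)² + 4 r² f(r²) f′(r²) + 2 r⁴ f′(r²)² ]. -/
open scoped BigOperators
open MeasureTheory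

namespace SphMom

abbrev EE (n : ℕ) := EuclideanSpace ℝ (Fin n)

/-- Gaussian weight. -/
noncomputable def gw (n : ℕ) (x : EE n) : ℝ := Real.exp (-(1/2) * ‖x‖ ^ 2)

lemma gw_cont (n : ℕ) : Continuous (gw n) := by unfold gw; fun_prop

lemma integrable_norm_pow (n : ℕ) (hn : 3 ≤ n) (k : ℕ) :
    Integrable (fun x : EE n => ‖x‖ ^ k * gw n x) := by
  have : Nonempty (Fin n) := ⟨⟨0, by omega⟩⟩
  have : Nontrivial (EE n) := inferInstance
  have := (integrable_fun_norm_addHaar (volume : Measure (EE n))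
    (f := fun t : ℝ => t ^ k * Real.exp (-(1/2) * t ^ 2))).2 ?_
  · exact this
  · have h := integrableOn_rpow_mul_exp_neg_mul_sq (b := 1/2) (by norm_num)
      (s := ((n - 1 + k : ℕ) : ℝ)) (by linarith [Nat.cast_nonneg (α := ℝ) (n - 1 + k)])
    refine h.congr_fun (fun t _ => ?_) measurableSet_Ioi
    simp only [finrank_euclideanSpace, Fintype.card_fin, smul_eq_mul, Real.rpow_natCast, pow_add]
    ring

lemma integrable_of_bound (n : ℕ) (hn : 3 ≤ n) (k : ℕ) (g : EE n → ℝ) (hg : Continuous g)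
    (C : ℝ) (hb : ∀ x, |g x| ≤ C * ‖x‖ ^ k) : Integrable (fun x => g x * gw n x) := by
  refine ((integrable_norm_pow n hn k).const_mul C).mono'
    (hg.mul (gw_cont n)).aestronglyMeasurable (Filter.Eventually.of_forall fun x => ?_)
  have : 0 < gw n x := Real.exp_pos _
  rw [Real.norm_eq_abs, abs_mul, abs_of_pos this, ← mul_assoc]
  exact mul_le_mul_of_nonneg_right (hb x) this.le

lemma abs_coord (n : ℕ) (x : EE n) (p : Fin n) : |x p| ≤ ‖x‖ := PiLp.norm_apply_le x p

lemma polar (n : ℕ) (hn : 3 ≤ n) (k : ℕ) : ∃ C : ℝ, ∀ g : EE n → ℝ,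
    (∀ (t : ℝ) (x : EE n), 0 < t → g (t • x) = t ^ k * g x) →
    ∫ x, g x * gw n x = (∫ ω : Metric.sphere (0 : EE n) 1, g ω ∂(volume : Measure (EE n)).toSphere) * C := by
  refine ⟨∫ t : Set.Ioi (0:ℝ), t.1 ^ k * Real.exp (-(1/2) * t.1 ^ 2) ∂.volumeIoiPow (Module.finrank ℝ (EE n) - 1), ?_⟩
  intro g hg
  have : Nonempty (Fin n) := ⟨⟨0, by omega⟩⟩
  have : Nontrivial (EE n) := inferInstance
  rw [← integral_prod_mul]
  calc ∫ x, g x * gw n x = ∫ x : ({(0)}ᶜ : Set (EE n)), g x * gw n x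
      ∂((volume : Measure (EE n)).comap (↑)) := by
        rw [integral_subtype_comap (measurableSet_singleton _).compl fun x ↦ g x * gw n x,
          restrict_compl_singleton]
    _ = _ := by
      rw [← (volume : Measure (EE n)).measurePreserving_homeomorphUnitSphereProd.integral_comp
        (Homeomorph.measurableEmbedding _)]
      refine integral_congr_ae (Filter.Eventually.of_forall fun x => ?_)
      have hx : 0 < ‖(x : EE n)‖ := norm_pos_iff.2 x.2
      have h1 := hg ‖(x : EE n)‖ (‖(x : EE n)‖⁻¹ • (x : EE n)) hx
      rw [smul_smul, mul_inv_cancel₀ hx.ne', one_smul] at h1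
      simp only [homeomorphUnitSphereProd_apply_snd_coe, homeomorphUnitSphereProd_apply_fst_coe]
      rw [h1, gw]; ring

lemma hasFDerivAt_gw (n : ℕ) (x : EE n) :
    HasFDerivAt (gw n) (-(gw n x) • innerSL ℝ x) x := by
  have h := ((hasStrictFDerivAt_norm_sq x).hasFDerivAt.const_mul (-(1/2) : ℝ)).exp
  have e : (-(gw n x) • innerSL ℝ x : EE n →L[ℝ] ℝ)
      = Real.exp (-(1 / 2) * ‖x‖ ^ 2) • (-(1 / 2) : ℝ) • (2 : ℕ) • innerSL ℝ x := by
    ext v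
    simp [gw]
    try ring
  rw [e]
  exact h

lemma stein (n : ℕ) (p : Fin n) (g : EE n → ℝ) (hg : Differentiable ℝ g)
    (h1 : Integrable (fun x => g x * gw n x))
    (h2 : Integrable (fun x => pder n p g x * gw n x))
    (h3 : Integrable (fun x => (x p * g x) * gw n x)) :
    ∫ x, (x p * g x) * gw n x = ∫ x, pder n p g x * gw n x := by
  have e : ∀ x : EE n, g x * fderiv ℝ (gw n) x (EuclideanSpace.single p 1)
      = -((x p * g x) * gw n x) := by
    intro x
    rw [(hasFDerivAt_gw n x).fderiv]
    simp [EuclideanSpace.inner_single_right]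
    ring
  have := integral_mul_fderiv_eq_neg_fderiv_mul_of_integrable (μ := (volume : Measure (EE n)))
    (f := g) (g := gw n) (v := EuclideanSpace.single p 1) h2 (by simp_rw [e]; exact h3.neg) h1
    (fun x _ => hg x) (fun x _ => (hasFDerivAt_gw n x).differentiableAt)
  simp_rw [e, integral_neg] at this
  exact neg_injective this

lemma pder_coord (n : ℕ) (p q : Fin n) (x : EE n) :
    pder n p (fun y : EE n => y q) x = if q = p then 1 else 0 := by
  unfold pder
  have : HasFDerivAt (fun y : EE n => y q) (EuclideanSpace.proj (𝕜 := ℝ) q : EE n →L[ℝ] ℝ) x :=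
    (EuclideanSpace.proj (𝕜 := ℝ) q : EE n →L[ℝ] ℝ).hasFDerivAt
  rw [this.fderiv]
  simp

lemma pder_mul (n : ℕ) (p : Fin n) (f g : EE n → ℝ) (x : EE n) (hf : DifferentiableAt ℝ f x)
    (hg : DifferentiableAt ℝ g x) :
    pder n p (fun y => f y * g y) x = pder n p f x * g x + f x * pder n p g x := by
  unfold pder
  rw [fderiv_fun_mul hf hg]
  simp
  ring

lemma coord_diff (n : ℕ) (q : Fin n) : Differentiable ℝ (fun y : EE n => y q) := by fun_prop

lemma gint0 (n : ℕ) (hn : 3 ≤ n) : Integrable (gw n) := by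
  simpa using integrable_norm_pow n hn 0
lemma gint1 (n : ℕ) (hn : 3 ≤ n) (p : Fin n) : Integrable (fun x : EE n => x p * gw n x) :=
  integrable_of_bound n hn 1 _ (by fun_prop) 1 (fun x => by simpa using abs_coord n x p)
lemma gint2 (n : ℕ) (hn : 3 ≤ n) (p q : Fin n) :
    Integrable (fun x : EE n => (x p * x q) * gw n x) :=
  integrable_of_bound n hn 2 _ (by fun_prop) 1 (fun x => by
    rw [abs_mul, one_mul, pow_two]
    have := abs_coord n x
    gcongr <;> apply this)
lemma gint3 (n : ℕ) (hn : 3 ≤ n) (p q r : Fin n) :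
    Integrable (fun x : EE n => (x p * (x q * x r)) * gw n x) :=
  integrable_of_bound n hn 3 _ (by fun_prop) 1 (fun x => by
    rw [abs_mul, abs_mul, one_mul, pow_succ', pow_two]
    have := abs_coord n x
    gcongr <;> apply this)
lemma gint4 (n : ℕ) (hn : 3 ≤ n) (p q r s : Fin n) :
    Integrable (fun x : EE n => (x p * (x q * (x r * x s))) * gw n x) :=
  integrable_of_bound n hn 4 _ (by fun_prop) 1 (fun x => by
    rw [abs_mul, abs_mul, abs_mul, one_mul, pow_succ', pow_succ', pow_two]
    have := abs_coord n x
    gcongr <;> apply this)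

noncomputable def dl {n : ℕ} (p q : Fin n) : ℝ := if p = q then 1 else 0

lemma gm2 (n : ℕ) (hn : 3 ≤ n) (p q : Fin n) :
    ∫ x : EE n, (x p * x q) * gw n x = dl q p * ∫ x, gw n x := by
  have e : (fun x : EE n => pder n p (fun y : EE n => y q) x * gw n x)
    = fun x => dl q p * gw n x := by
    funext x; rw [pder_coord]; rfl
  rw [stein n p (fun y => y q) (coord_diff n q) (gint1 n hn q)
    (by rw [e]; exact (gint0 n hn).const_mul _) (gint2 n hn p q), e, integral_const_mul]

lemma gm4 (n : ℕ) (hn : 3 ≤ n) (p q r s : Fin n) :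
    ∫ x : EE n, (x p * (x q * (x r * x s))) * gw n x
      = (dl q p * dl s r + dl r p * dl s q + dl s p * dl r q) * ∫ x, gw n x := by
  have e : (fun x : EE n => pder n p (fun y : EE n => y q * (y r * y s)) x * gw n x)
    = fun x => dl q p * ((x r * x s) * gw n x) + dl r p * ((x q * x s) * gw n x)
       + dl s p * ((x q * x r) * gw n x) := by
    funext x
    rw [pder_mul n p (fun y => y q) (fun y => y r * y s) x (coord_diff n q x) ((coord_diff n r x).mul (coord_diff n s x)),
      pder_mul n p (fun y => y r) (fun y => y s) x (coord_diff n r x) (coord_diff n s x), pder_coord, pder_coord, pder_coord]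
    change (dl q p * _ + _ * (dl r p * _ + _ * dl s p)) * _ = _
    ring
  have i1 := (gint2 n hn r s).const_mul (dl q p)
  have i2 := (gint2 n hn q s).const_mul (dl r p)
  have i3 := (gint2 n hn q r).const_mul (dl s p)
  rw [stein n p (fun y => y q * (y r * y s))
    ((coord_diff n q).mul ((coord_diff n r).mul (coord_diff n s))) (gint3 n hn q r s)
    (by rw [e]; exact (i1.add i2).add i3) (gint4 n hn p q r s), e,
    integral_add (by exact i1.add i2) i3, integral_add i1 i2, integral_const_mul, integral_const_mul,
    integral_const_mul, gm2 n hn, gm2 n hn, gm2 n hn]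
  ring

lemma gpos (n : ℕ) (hn : 3 ≤ n) : 0 < ∫ x, gw n x := by
  have : Nonempty (Fin n) := ⟨⟨0, by omega⟩⟩
  exact integral_exp_pos (gint0 n hn)

lemma sph_int (n : ℕ) (g : EE n → ℝ) (hg : Continuous g) :
    Integrable (fun ω : Metric.sphere (0 : EE n) 1 => g ω) (volume : Measure (EE n)).toSphere := by
  have : CompactSpace (Metric.sphere (0 : EE n) 1) := inferInstance
  exact (hg.comp continuous_subtype_val).integrable_of_hasCompactSupport
    (HasCompactSupport.of_compactSpace _)

lemma sum_sq (n : ℕ) (x : EE n) : ∑ p, x p * x p = ‖x‖ ^ 2 := by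
  rw [EuclideanSpace.real_norm_sq_eq]
  simp [pow_two]

lemma sphereArea_eq (n : ℕ) : ∫ _ω : Metric.sphere (0 : EE n) 1, (1:ℝ) ∂(volume : Measure (EE n)).toSphere = sphereArea n := by
  simp only [integral_const, smul_eq_mul, mul_one]; rfl

lemma sm2 (n : ℕ) (hn : 3 ≤ n) (p q : Fin n) :
    ∫ ω : Metric.sphere (0 : EE n) 1, ω.1 p * ω.1 q ∂(volume : Measure (EE n)).toSphere
      = dl q p * (sphereArea n / n) := by
  obtain ⟨C, hC⟩ := polar n hn 2
  have key : ∀ p q : Fin n, dl q p * ∫ x, gw n x =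
    (∫ ω : Metric.sphere (0 : EE n) 1, ω.1 p * ω.1 q ∂(volume : Measure (EE n)).toSphere) * C := by
    intro p q
    rw [← gm2 n hn, hC (fun x => x p * x q)]
    intro t x _
    simp only [PiLp.smul_apply, smul_eq_mul]; ring
  have hs : (n : ℝ) * ∫ x, gw n x = sphereArea n * C := by
    rw [← sphereArea_eq]
    have : ∀ ω : Metric.sphere (0 : EE n) 1, (1:ℝ) = ∑ p, ω.1 p * ω.1 p := by
      intro ω; rw [sum_sq]; simp
    rw [integral_congr_ae (Filter.Eventually.of_forall this), integral_finsetSum _ (fun p _ => sph_int n (fun x => x p * x p) (by fun_prop)),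
      Finset.sum_mul]
    simp_rw [← key]
    simp [dl]
  have hn0 : (n : ℝ) ≠ 0 := by positivity
  have hC0 : C ≠ 0 := by
    rintro rfl
    have := gpos n hn
    rw [mul_zero] at hs
    exact (mul_ne_zero hn0 this.ne') hs
  apply mul_right_cancel₀ hC0
  rw [← key]
  field_simp
  linear_combination (dl q p) * hs

lemma sm4 (n : ℕ) (hn : 3 ≤ n) (p q r s : Fin n) :
    ∫ ω : Metric.sphere (0 : EE n) 1, ω.1 p * (ω.1 q * (ω.1 r * ω.1 s))
        ∂(volume : Measure (EE n)).toSphere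
      = (dl q p * dl s r + dl r p * dl s q + dl s p * dl r q)
        * (sphereArea n / (n * (n + 2))) := by
  obtain ⟨C, hC⟩ := polar n hn 4
  have key : ∀ p q r s : Fin n,
    (dl q p * dl s r + dl r p * dl s q + dl s p * dl r q) * ∫ x, gw n x =
    (∫ ω : Metric.sphere (0 : EE n) 1, ω.1 p * (ω.1 q * (ω.1 r * ω.1 s))
        ∂(volume : Measure (EE n)).toSphere) * C := by
    intro p q r s
    rw [← gm4 n hn, hC (fun x => x p * (x q * (x r * x s)))]
    intro t x _
    simp only [PiLp.smul_apply, smul_eq_mul]; ring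
  have hs : (n : ℝ) * (n + 2) * ∫ x, gw n x = sphereArea n * C := by
    rw [← sphereArea_eq]
    have : ∀ ω : Metric.sphere (0 : EE n) 1, (1:ℝ) =
        ∑ p, ∑ q, ω.1 p * (ω.1 p * (ω.1 q * ω.1 q)) := by
      intro ω
      have h := sum_sq n ω.1
      simp_rw [← Finset.mul_sum, h]
      simp [h]
    rw [integral_congr_ae (Filter.Eventually.of_forall this), integral_finsetSum _ (fun p _ => sph_int n
      (fun x => ∑ q, x p * (x p * (x q * x q))) (by fun_prop)), Finset.sum_mul]
    have h2 : ∀ p : Fin n, (∫ ω : Metric.sphere (0 : EE n) 1,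
        ∑ q, ω.1 p * (ω.1 p * (ω.1 q * ω.1 q)) ∂(volume : Measure (EE n)).toSphere) * C
        = ((n:ℝ) + 2) * ∫ x, gw n x := by
      intro p
      rw [integral_finsetSum _ (fun q _ => sph_int n
        (fun x => x p * (x p * (x q * x q))) (by fun_prop)), Finset.sum_mul]
      simp_rw [← key, ← Finset.sum_mul]
      congr 1
      simp [dl, Finset.sum_add_distrib]
      ring
    simp_rw [h2]
    simp
    ring
  have hn0 : (n : ℝ) ≠ 0 := by positivity
  have hn2 : (n : ℝ) + 2 ≠ 0 := by positivity
  have hC0 : C ≠ 0 := by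
    rintro rfl
    have := gpos n hn
    rw [mul_zero] at hs
    exact (mul_ne_zero (mul_ne_zero hn0 hn2) this.ne') hs
  apply mul_right_cancel₀ hC0
  rw [← key]
  field_simp
  linear_combination (dl q p * dl s r + dl r p * dl s q + dl s p * dl r q) * hs

end SphMom

namespace SphMom

lemma lin_sq (n : ℕ) (hn : 3 ≤ n) (a : Fin n → ℝ) :
    ∫ ω : Metric.sphere (0 : EE n) 1, (∑ q, a q * ω.1 q) ^ 2 ∂(volume : Measure (EE n)).toSphere
      = sphereArea n / n * ∑ q, a q ^ 2 := by
  have e : ∀ ω : Metric.sphere (0 : EE n) 1, (∑ q, a q * ω.1 q) ^ 2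
      = ∑ p, ∑ q, (a p * a q) * (ω.1 p * ω.1 q) := by
    intro ω
    rw [pow_two, Finset.sum_mul_sum]
    refine Finset.sum_congr rfl fun p _ => Finset.sum_congr rfl fun q _ => by ring
  rw [integral_congr_ae (Filter.Eventually.of_forall e),
    integral_finsetSum _ (fun p _ => sph_int n
      (fun x => ∑ q, (a p * a q) * (x p * x q)) (by fun_prop)), Finset.mul_sum]
  refine Finset.sum_congr rfl fun p _ => ?_
  rw [integral_finsetSum _ (fun q _ => sph_int n
      (fun x => (a p * a q) * (x p * x q)) (by fun_prop))]
  simp_rw [integral_const_mul, sm2 n hn]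
  simp [dl]
  ring

lemma quad_sq (n : ℕ) (hn : 3 ≤ n) (B : Fin n → Fin n → ℝ) (hB : ∑ p, B p p = 0) :
    ∫ ω : Metric.sphere (0 : EE n) 1, (∑ p, ∑ q, B p q * ω.1 p * ω.1 q) ^ 2
        ∂(volume : Measure (EE n)).toSphere
      = sphereArea n / (n * (n + 2)) * (1 / 2 * ∑ p, ∑ q, (B p q + B q p) ^ 2) := by
  have e : ∀ ω : Metric.sphere (0 : EE n) 1, (∑ p, ∑ q, B p q * ω.1 p * ω.1 q) ^ 2
      = ∑ p, ∑ r, ∑ q, ∑ s, (B p q * B r s) * (ω.1 p * (ω.1 q * (ω.1 r * ω.1 s))) := by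
    intro ω
    rw [pow_two, Finset.sum_mul_sum]
    refine Finset.sum_congr rfl fun p _ => Finset.sum_congr rfl fun r _ => ?_
    rw [Finset.sum_mul_sum]
    refine Finset.sum_congr rfl fun q _ => Finset.sum_congr rfl fun s _ => by ring
  have e2 : ∫ ω : Metric.sphere (0 : EE n) 1, (∑ p, ∑ q, B p q * ω.1 p * ω.1 q) ^ 2
        ∂(volume : Measure (EE n)).toSphere
      = ∑ p, ∑ r, ∑ q, ∑ s, (B p q * B r s) *
      ((dl q p * dl s r + dl r p * dl s q + dl s p * dl r q)
        * (sphereArea n / (n * (n + 2)))) := by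
    rw [integral_congr_ae (Filter.Eventually.of_forall e),
      integral_finsetSum _ (fun p _ => sph_int n
      (fun x => ∑ r, ∑ q, ∑ s, (B p q * B r s) * (x p * (x q * (x r * x s)))) (by fun_prop))]
    refine Finset.sum_congr rfl fun p _ => ?_
    rw [integral_finsetSum _ (fun r _ => sph_int n
      (fun x => ∑ q, ∑ s, (B p q * B r s) * (x p * (x q * (x r * x s)))) (by fun_prop))]
    refine Finset.sum_congr rfl fun r _ => ?_
    rw [integral_finsetSum _ (fun q _ => sph_int n
      (fun x => ∑ s, (B p q * B r s) * (x p * (x q * (x r * x s)))) (by fun_prop))]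
    refine Finset.sum_congr rfl fun q _ => ?_
    rw [integral_finsetSum _ (fun s _ => sph_int n
      (fun x => (B p q * B r s) * (x p * (x q * (x r * x s)))) (by fun_prop))]
    refine Finset.sum_congr rfl fun s _ => ?_
    rw [integral_const_mul, sm4 n hn]
  have t1 : ∑ p, ∑ r, ∑ q, ∑ s, (B p q * B r s) * (dl q p * dl s r) = 0 := by
    have : ∀ p r : Fin n, ∑ q, ∑ s, (B p q * B r s) * (dl q p * dl s r) = B p p * B r r := by
      intro p r
      simp [dl]
    simp_rw [this, ← Finset.mul_sum, hB]
    simp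
  have t2 : ∑ p, ∑ r, ∑ q, ∑ s, (B p q * B r s) * (dl r p * dl s q) = ∑ p, ∑ q, B p q * B p q := by
    simp [dl]
  have t3 : ∑ p, ∑ r, ∑ q, ∑ s, (B p q * B r s) * (dl s p * dl r q) = ∑ p, ∑ q, B p q * B q p := by
    simp [dl]
  have t4 : ∑ p, ∑ q, (B p q + B q p) ^ 2
      = 2 * ∑ p, ∑ q, B p q * B p q + 2 * ∑ p, ∑ q, B p q * B q p := by
    have c : ∑ p, ∑ q, B q p * B q p = ∑ p, ∑ q, B p q * B p q := Finset.sum_comm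
    have : ∀ p q, (B p q + B q p) ^ 2 = B p q * B p q + B q p * B q p + 2 * (B p q * B q p) := by
      intro p q; ring
    simp_rw [this, Finset.sum_add_distrib, ← Finset.mul_sum]
    rw [c]; ring
  rw [e2, t4]
  simp_rw [← mul_assoc _ _ (sphereArea n / (n * (n + 2))), ← Finset.sum_mul, mul_add,
    Finset.sum_add_distrib]
  rw [t1, t2, t3]
  ring

/-- derivative of the quadratic form -/
noncomputable def DH (n : ℕ) (W : Fin n → Fin n → Fin n → Fin n → ℝ) (i k l : Fin n)
    (x : EE n) : ℝ := ∑ q, (W i l k q + W i q k l) * x q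

noncomputable def fp (s : ℝ) : ℝ := 5 - 2 * s + 3 * s ^ 2 / 20

lemma hasDerivAt_fpoly (τ s : ℝ) : HasDerivAt (fpoly τ) (fp s) s := by
  unfold fpoly fp
  have := ((((hasDerivAt_id' s).const_mul 5).const_add τ).sub (hasDerivAt_pow 2 s)).add
    ((hasDerivAt_pow 3 s).div_const 20)
  have e : (5 * 1 - ((2 : ℕ) : ℝ) * s ^ (2 - 1) + ((3 : ℕ) : ℝ) * s ^ (3 - 1) / 20)
      = 5 - 2 * s + 3 * s ^ 2 / 20 := by norm_num
  rw [e] at this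
  exact this

lemma Hten_diff (n : ℕ) (W : Fin n → Fin n → Fin n → Fin n → ℝ) (i k : Fin n) :
    Differentiable ℝ (Hten n W i k) := by
  unfold Hten; fun_prop

lemma pder_Hten (n : ℕ) (W : Fin n → Fin n → Fin n → Fin n → ℝ) (i k l : Fin n) (x : EE n) :
    pder n l (Hten n W i k) x = DH n W i k l x := by
  have h : ∀ p q : Fin n, HasFDerivAt (fun y : EE n => W i p k q * y p * y q)
      ((W i p k q * x p) • (EuclideanSpace.proj (𝕜 := ℝ) q : EE n →L[ℝ] ℝ)
        + x q • (W i p k q • (EuclideanSpace.proj (𝕜 := ℝ) p : EE n →L[ℝ] ℝ))) x := by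
    intro p q
    exact ((EuclideanSpace.proj (𝕜 := ℝ) p : EE n →L[ℝ] ℝ).hasFDerivAt.const_mul (W i p k q)).mul
      (EuclideanSpace.proj (𝕜 := ℝ) q : EE n →L[ℝ] ℝ).hasFDerivAt
  have h2 : HasFDerivAt (Hten n W i k) (∑ p, ∑ q,
      ((W i p k q * x p) • (EuclideanSpace.proj (𝕜 := ℝ) q : EE n →L[ℝ] ℝ)
        + x q • (W i p k q • (EuclideanSpace.proj (𝕜 := ℝ) p : EE n →L[ℝ] ℝ)))) x := by
    unfold Hten
    exact HasFDerivAt.fun_sum fun p _ => HasFDerivAt.fun_sum fun q _ => h p q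
  unfold pder DH
  rw [h2.fderiv]
  simp [Finset.sum_add_distrib, add_mul, mul_comm, add_comm]

lemma pder_Hbar (n : ℕ) (W : Fin n → Fin n → Fin n → Fin n → ℝ) (τ : ℝ) (i k l : Fin n)
    (x : EE n) : pder n l (Hbar n W τ i k) x
      = 2 * x l * fp (‖x‖ ^ 2) * Hten n W i k x + fpoly τ (‖x‖ ^ 2) * DH n W i k l x := by
  have h := (hasDerivAt_fpoly τ (‖x‖ ^ 2)).comp_hasFDerivAt x
    (hasStrictFDerivAt_norm_sq x).hasFDerivAt
  have h' := pder_mul n l (fpoly τ ∘ fun x => ‖x‖ ^ 2) (Hten n W i k) x h.differentiableAt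
    (Hten_diff n W i k x)
  have e : pder n l (fpoly τ ∘ fun x => ‖x‖ ^ 2) x = 2 * x l * fp (‖x‖ ^ 2) := by
    unfold pder
    rw [h.fderiv]
    simp [EuclideanSpace.inner_single_right]
    ring
  rw [e, pder_Hten] at h'
  exact h'

lemma euler (n : ℕ) (W : Fin n → Fin n → Fin n → Fin n → ℝ) (i k : Fin n) (x : EE n) :
    ∑ l, x l * DH n W i k l x = 2 * Hten n W i k x := by
  have c : ∑ l, ∑ q, W i q k l * x q * x l = Hten n W i k x := Finset.sum_comm
  have : ∀ l, x l * DH n W i k l x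
      = ∑ q, W i l k q * x l * x q + ∑ q, W i q k l * x q * x l := by
    intro l
    unfold DH
    rw [Finset.mul_sum, ← Finset.sum_add_distrib]
    exact Finset.sum_congr rfl fun q _ => by ring
  simp_rw [this, Finset.sum_add_distrib]
  rw [c]; unfold Hten; ring

lemma grad_sq (n : ℕ) (W : Fin n → Fin n → Fin n → Fin n → ℝ) (τ : ℝ) (i k : Fin n)
    (x : EE n) : ∑ l, (pder n l (Hbar n W τ i k) x) ^ 2
      = (4 * ‖x‖ ^ 2 * fp (‖x‖ ^ 2) ^ 2 + 8 * fpoly τ (‖x‖ ^ 2) * fp (‖x‖ ^ 2))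
          * Hten n W i k x ^ 2
        + fpoly τ (‖x‖ ^ 2) ^ 2 * ∑ l, DH n W i k l x ^ 2 := by
  have : ∀ l, (pder n l (Hbar n W τ i k) x) ^ 2 =
      4 * fp (‖x‖ ^ 2) ^ 2 * Hten n W i k x ^ 2 * (x l * x l)
      + 4 * fp (‖x‖ ^ 2) * fpoly τ (‖x‖ ^ 2) * Hten n W i k x * (x l * DH n W i k l x)
      + fpoly τ (‖x‖ ^ 2) ^ 2 * DH n W i k l x ^ 2 := by
    intro l; rw [pder_Hbar]; ring
  simp_rw [this, Finset.sum_add_distrib, ← Finset.mul_sum]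
  rw [sum_sq, euler]
  ring

lemma cont_Hten (n : ℕ) (W : Fin n → Fin n → Fin n → Fin n → ℝ) (i k : Fin n) :
    Continuous (Hten n W i k) := (Hten_diff n W i k).continuous

lemma cont_DH (n : ℕ) (W : Fin n → Fin n → Fin n → Fin n → ℝ) (i k l : Fin n) :
    Continuous (DH n W i k l) := by unfold DH; fun_prop

lemma cont_grad (n : ℕ) (W : Fin n → Fin n → Fin n → Fin n → ℝ) (τ : ℝ) (i k : Fin n) :
    Continuous (fun x => ∑ l, (pder n l (Hbar n W τ i k) x) ^ 2) := by
  simp_rw [grad_sq]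
  have h1 := cont_Hten n W i k
  have h2 := cont_DH n W i k
  have h3 : Continuous (fpoly τ) := by unfold fpoly; fun_prop
  have h4 : Continuous fp := by unfold fp; fun_prop
  fun_prop

lemma integral_grad (n : ℕ) (hn : 3 ≤ n) (W : Fin n → Fin n → Fin n → Fin n → ℝ) (τ r : ℝ)
    (hr : 0 < r) (i k : Fin n) (htr : ∑ p, W i p k p = 0) :
    ∫ ω : Metric.sphere (0 : EE n) 1, ∑ l, (pder n l (Hbar n W τ i k) (r • ω.1)) ^ 2
        ∂(volume : Measure (EE n)).toSphere
      = (4 * r ^ 2 * fp (r ^ 2) ^ 2 + 8 * fpoly τ (r ^ 2) * fp (r ^ 2)) * r ^ 4 *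
          (sphereArea n / (n * (n + 2)) * (1 / 2 * ∑ p, ∑ q, (W i p k q + W i q k p) ^ 2))
        + fpoly τ (r ^ 2) ^ 2 * r ^ 2 *
          (sphereArea n / n * ∑ p, ∑ q, (W i p k q + W i q k p) ^ 2) := by
  have e : ∀ ω : Metric.sphere (0 : EE n) 1, ∑ l, (pder n l (Hbar n W τ i k) (r • ω.1)) ^ 2
      = (4 * r ^ 2 * fp (r ^ 2) ^ 2 + 8 * fpoly τ (r ^ 2) * fp (r ^ 2)) * r ^ 4 *
          Hten n W i k ω.1 ^ 2
        + fpoly τ (r ^ 2) ^ 2 * r ^ 2 * ∑ l, DH n W i k l ω.1 ^ 2 := by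
    intro ω
    have hnorm : ‖r • ω.1‖ = r := by simp [norm_smul, abs_of_pos hr]
    have hH : Hten n W i k (r • ω.1) = r ^ 2 * Hten n W i k ω.1 := by
      unfold Hten
      simp_rw [Finset.mul_sum]
      refine Finset.sum_congr rfl fun p _ => Finset.sum_congr rfl fun q _ => ?_
      simp only [PiLp.smul_apply, smul_eq_mul]; ring
    have hD : ∀ l, DH n W i k l (r • ω.1) = r * DH n W i k l ω.1 := by
      intro l
      unfold DH
      simp_rw [Finset.mul_sum]
      refine Finset.sum_congr rfl fun q _ => ?_
      simp only [PiLp.smul_apply, smul_eq_mul]; ring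
    rw [grad_sq, hnorm, hH]
    simp_rw [hD, mul_pow, ← Finset.mul_sum]
    ring
  have c1 := cont_Hten n W i k
  have c2 := cont_DH n W i k
  rw [integral_congr_ae (Filter.Eventually.of_forall e),
    integral_add ((sph_int n (fun x => Hten n W i k x ^ 2) (by fun_prop)).const_mul _)
      ((sph_int n (fun x => ∑ l, DH n W i k l x ^ 2) (by fun_prop)).const_mul _),
    integral_const_mul, integral_const_mul,
    integral_finsetSum _ (fun l _ => sph_int n (fun x => DH n W i k l x ^ 2) (by fun_prop))]
  congr 2
  · exact quad_sq n hn (fun p q => W i p k q) htr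
  · rw [Finset.mul_sum]
    exact Finset.sum_congr rfl fun l _ => lin_sq n hn (fun q => W i l k q + W i q k l)

lemma integral_surf (n : ℕ) (r : ℝ) (hr : 0 < r) (g : EE n → ℝ) (hg : Continuous g) :
    ∫ x, g x ∂(surfMeasure n r) = r ^ (n - 1) *
      ∫ ω : Metric.sphere (0 : EE n) 1, g (r • ω.1) ∂(volume : Measure (EE n)).toSphere := by
  unfold surfMeasure
  rw [integral_smul_measure, integral_map (by fun_prop) hg.aestronglyMeasurable,
    ENNReal.toReal_ofReal (by positivity), smul_eq_mul]

end SphMom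

theorem stmt_9 (n : ℕ) (hn : 3 ≤ n) (W : Fin n → Fin n → Fin n → Fin n → ℝ)
    (hsymm1 : ∀ i j k l, W i j k l = - W j i k l)
    (hsymm2 : ∀ i j k l, W i j k l = - W i j l k)
    (hsymm3 : ∀ i j k l, W i j k l = W k l i j)
    (hBianchi : ∀ i j k l, W i j k l + W i k l j + W i l j k = 0)
    (htrace : ∀ j l, ∑ i, W i j i l = 0)
    (τ : ℝ) (r : ℝ) (hr : 0 < r) :
    ∫ x, ∑ i, ∑ k, ∑ l, (pder n l (Hbar n W τ i k) x) ^ 2 ∂(surfMeasure n r)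
      = 1 / ((n : ℝ) * ((n : ℝ) + 2)) * sphereArea n *
          (∑ i, ∑ j, ∑ k, ∑ l, (W i j k l + W i l k j) ^ 2) *
          (r ^ (n + 1) *
            (((n : ℝ) + 2) * fpoly τ (r ^ 2) ^ 2
              + 4 * r ^ 2 * fpoly τ (r ^ 2) * deriv (fpoly τ) (r ^ 2)
              + 2 * r ^ 4 * (deriv (fpoly τ) (r ^ 2)) ^ 2)) := by
  have htr : ∀ i k, ∑ p, W i p k p = 0 := by
    intro i k
    rw [← htrace i k]
    refine Finset.sum_congr rfl fun p _ => ?_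
    rw [hsymm1 i p k p, hsymm2 p i k p, neg_neg]
  have hc := fun i k => SphMom.cont_grad n W τ i k
  have hsc : Continuous (fun ω : SphMom.EE n => r • ω) := by fun_prop
  have hci : ∀ i k, Integrable (fun ω : Metric.sphere (0 : SphMom.EE n) 1 =>
      ∑ l, (pder n l (Hbar n W τ i k) (r • ω.1)) ^ 2)
      (volume : Measure (SphMom.EE n)).toSphere :=
    fun i k => SphMom.sph_int n _ ((hc i k).comp hsc)
  rw [SphMom.integral_surf n r hr _ (by fun_prop),
    integral_finsetSum _ (fun i _ => integrable_finsetSum _ (fun k _ => hci i k))]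
  have e : ∀ i, ∫ ω : Metric.sphere (0 : SphMom.EE n) 1,
      ∑ k, ∑ l, (pder n l (Hbar n W τ i k) (r • ω.1)) ^ 2
        ∂(volume : Measure (SphMom.EE n)).toSphere = _ := fun i =>
    (integral_finsetSum _ (fun k _ => hci i k)).trans
      (Finset.sum_congr rfl fun k _ => SphMom.integral_grad n hn W τ r hr i k (htr i k))
  rw [Finset.sum_congr rfl fun i _ => e i]
  have hS : ∑ i, ∑ j, ∑ k, ∑ l, (W i j k l + W i l k j) ^ 2
      = ∑ i, ∑ k, ∑ p, ∑ q, (W i p k q + W i q k p) ^ 2 :=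
    Finset.sum_congr rfl fun i _ => Finset.sum_comm
  rw [hS, (SphMom.hasDerivAt_fpoly τ (r ^ 2)).deriv]
  simp_rw [Finset.sum_add_distrib, ← Finset.mul_sum]
  obtain ⟨m, rfl⟩ : ∃ m, n = m + 1 := ⟨n - 1, by omega⟩
  have hn0 : ((m + 1 : ℕ) : ℝ) ≠ 0 := by positivity
  have hn2 : ((m + 1 : ℕ) : ℝ) + 2 ≠ 0 := by positivity
  rw [Nat.add_sub_cancel]
  generalize ((m + 1 : ℕ) : ℝ) = N at *
  field_simp
  ring
end

section
/- Assume n ≥ 19. Then for every ε > 0: ∫_{ℝⁿ} ε^{n−2} (ε² + |x|²)^{2−n} Σ_{i,k,l=1}^n (∂_l H̄_{ik}(x))² dx = (1/(n(n+2))) |S^{n−1}| Σ_{i,j,k,l=1}^n (W_{ijkl} + W_{ilkj})² · ∫_0^∞ ε^{n−2} (ε² + r²)^{2−n} r^{n+1} [ (n+2) f(r²)² + 4 r² f(r²) f′(r²) + 2 r⁴ f′(r²)² ] dr, and both integrals are finite. -/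
open scoped BigOperators
open MeasureTheory

theorem aux_deriv_fpoly (τ s : ℝ) : deriv (fpoly τ) s = 5 - 2 * s + 3 * s ^ 2 / 20 := by
  have h : HasDerivAt (fpoly τ) (5 - 2 * s + 3 * s ^ 2 / 20) s := by
    unfold fpoly
    have h1 := ((((hasDerivAt_id s).const_mul 5).const_add τ).sub ((hasDerivAt_id s).pow 2)).add
      (((hasDerivAt_id s).pow 3).div_const 20)
    refine h1.congr_deriv ?_
    simp only [id]
    ring
  exact h.deriv

theorem aux_hasDeriv_fpoly (τ s : ℝ) : HasDerivAt (fpoly τ) (deriv (fpoly τ) s) s := by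
  have : DifferentiableAt ℝ (fpoly τ) s := by unfold fpoly; fun_prop
  exact this.hasDerivAt

theorem aux_mono (n : ℕ) (hn : 19 ≤ n) (ε : ℝ) (hε : 0 < ε) (j : ℕ) (hj : j ≤ n + 13) :
    IntegrableOn (fun r : ℝ => (ε ^ 2 + r ^ 2) ^ ((2 : ℝ) - n) * r ^ j) (Set.Ioi (0 : ℝ)) := by
  have hn' : (19 : ℝ) ≤ n := by exact_mod_cast hn
  have hj' : (j : ℝ) ≤ n + 13 := by exact_mod_cast hj
  have hpos : ∀ r : ℝ, 0 < ε ^ 2 + r ^ 2 := fun r => by positivity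
  have hcont : Continuous (fun r : ℝ => (ε ^ 2 + r ^ 2) ^ ((2 : ℝ) - n) * r ^ j) := by
    refine Continuous.mul (Continuous.rpow_const (by fun_prop) fun r => Or.inl (hpos r).ne') (by fun_prop)
  set e : ℝ := (2 : ℝ) - n + j / 2 + 1 with he
  have he0 : e ≤ 0 := by rw [he]; linarith
  have hg : Integrable (fun r : ℝ => ((ε ^ 2) ^ e * (1 + (ε ^ 2)⁻¹)) * (1 + r ^ 2)⁻¹) :=
    integrable_inv_one_add_sq.const_mul _
  refine Integrable.mono' hg.integrableOn hcont.aestronglyMeasurable.restrict ?_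
  refine (ae_restrict_iff' measurableSet_Ioi).2 (Filter.Eventually.of_forall fun r hr => ?_)
  have hr : 0 < r := hr
  have hm := hpos r
  rw [Real.norm_of_nonneg (by positivity)]
  have h1 : r ^ j ≤ (ε ^ 2 + r ^ 2) ^ ((j : ℝ) / 2) := by
    have : r ^ j = (r ^ 2) ^ ((j : ℝ) / 2) := by
      rw [← Real.rpow_natCast r 2, ← Real.rpow_mul hr.le, ← Real.rpow_natCast]
      congr 1
      push_cast
      ring
    rw [this]
    exact Real.rpow_le_rpow (by positivity) (by nlinarith [sq_nonneg ε]) (by positivity)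
  calc (ε ^ 2 + r ^ 2) ^ ((2 : ℝ) - n) * r ^ j
      ≤ (ε ^ 2 + r ^ 2) ^ ((2 : ℝ) - n) * (ε ^ 2 + r ^ 2) ^ ((j : ℝ) / 2) := by gcongr
    _ = (ε ^ 2 + r ^ 2) ^ e * (ε ^ 2 + r ^ 2)⁻¹ := by
        rw [← Real.rpow_neg_one (ε ^ 2 + r ^ 2), ← Real.rpow_add hm, ← Real.rpow_add hm]
        congr 1
        rw [he]; ring
    _ ≤ (ε ^ 2) ^ e * ((1 + (ε ^ 2)⁻¹) * (1 + r ^ 2)⁻¹) := by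
        have h2 : (ε ^ 2 + r ^ 2) ^ e ≤ (ε ^ 2) ^ e :=
          Real.rpow_le_rpow_of_nonpos (by positivity) (by nlinarith) he0
        have h3 : (ε ^ 2 + r ^ 2)⁻¹ ≤ (1 + (ε ^ 2)⁻¹) * (1 + r ^ 2)⁻¹ := by
          rw [← div_eq_mul_inv, inv_eq_one_div, div_le_div_iff₀ hm (by positivity)]
          have : 0 ≤ (ε ^ 2)⁻¹ * r ^ 2 := by positivity
          have h4 : (ε ^ 2)⁻¹ * ε ^ 2 = 1 := inv_mul_cancel₀ (by positivity)
          nlinarith [sq_nonneg ε]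
        gcongr
    _ = _ := by ring

theorem aux_poly (n : ℕ) (hn : 19 ≤ n) (ε : ℝ) (hε : 0 < ε) (P : Polynomial ℝ)
    (hP : P.natDegree ≤ 12) :
    IntegrableOn (fun r : ℝ => ε ^ (n - 2) * (ε ^ 2 + r ^ 2) ^ ((2 : ℝ) - n) * r ^ (n + 1)
      * P.eval r) (Set.Ioi (0 : ℝ)) := by
  have : (fun r : ℝ => ε ^ (n - 2) * (ε ^ 2 + r ^ 2) ^ ((2 : ℝ) - n) * r ^ (n + 1)
      * P.eval r) = fun r => ∑ k ∈ Finset.range 13, (ε ^ (n - 2) * P.coeff k) *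
        ((ε ^ 2 + r ^ 2) ^ ((2 : ℝ) - n) * r ^ (n + 1 + k)) := by
    ext r
    rw [Polynomial.eval_eq_sum_range' (n := 13) (by omega), Finset.mul_sum]
    refine Finset.sum_congr rfl fun k _ => ?_
    rw [pow_add r (n+1) k]; ring
  rw [this]
  refine integrable_finsetSum _ fun k hk => ?_
  refine Integrable.const_mul (aux_mono n hn ε hε _ ?_) _
  have := Finset.mem_range.1 hk
  omega

section moments
variable {n : ℕ}

theorem aux_rot (g : ℝ → ℝ) (k : ℕ) (u v : EuclideanSpace ℝ (Fin n)) (h : ‖u‖ = ‖v‖) :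
    ∫ x : EuclideanSpace ℝ (Fin n), g ‖x‖ * (inner ℝ u x) ^ k
      = ∫ x : EuclideanSpace ℝ (Fin n), g ‖x‖ * (inner ℝ v x) ^ k := by
  obtain ⟨R, hR⟩ : ∃ R : EuclideanSpace ℝ (Fin n) ≃ₗᵢ[ℝ] EuclideanSpace ℝ (Fin n), R u = v :=
    ⟨_, Submodule.reflection_sub h⟩
  rw [← (R.measurePreserving).integral_comp R.toHomeomorph.measurableEmbedding
    (fun x => g ‖x‖ * (inner ℝ v x) ^ k)]
  simp [← hR]

theorem aux_hom (g : ℝ → ℝ) (k : ℕ) (e v : EuclideanSpace ℝ (Fin n)) (h : ‖e‖ = 1) :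
    ∫ x : EuclideanSpace ℝ (Fin n), g ‖x‖ * (inner ℝ v x) ^ k
      = ‖v‖ ^ k * ∫ x : EuclideanSpace ℝ (Fin n), g ‖x‖ * (inner ℝ e x) ^ k := by
  rw [aux_rot g k v (‖v‖ • e) (by simp [norm_smul, h]), ← integral_const_mul]
  congr 1
  ext x
  rw [real_inner_smul_left, mul_pow]; ring

theorem aux_int (g : ℝ → ℝ) (hg : Continuous g) (k : ℕ)
    (hi : Integrable fun x : EuclideanSpace ℝ (Fin n) => g ‖x‖ * ‖x‖ ^ k)
    (φ : EuclideanSpace ℝ (Fin n) → ℝ) (hφ : Continuous φ) (C : ℝ)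
    (hb : ∀ x, |φ x| ≤ C * ‖x‖ ^ k) :
    Integrable fun x : EuclideanSpace ℝ (Fin n) => g ‖x‖ * φ x := by
  refine Integrable.mono' (hi.norm.const_mul C) ?_ (Filter.Eventually.of_forall fun x => ?_)
  · exact (Continuous.mul (hg.comp continuous_norm) hφ).aestronglyMeasurable
  · have h1 := hb x
    simp only [norm_mul, norm_pow, Real.norm_eq_abs, abs_norm] at *
    nlinarith [mul_le_mul_of_nonneg_left h1 (abs_nonneg (g ‖x‖))]

theorem aux_int_inner (g : ℝ → ℝ) (hg : Continuous g) (k : ℕ)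
    (hi : Integrable fun x : EuclideanSpace ℝ (Fin n) => g ‖x‖ * ‖x‖ ^ k)
    (v : EuclideanSpace ℝ (Fin n)) :
    Integrable fun x : EuclideanSpace ℝ (Fin n) => g ‖x‖ * (inner ℝ v x) ^ k := by
  refine aux_int g hg k hi _ (by fun_prop) (‖v‖ ^ k) fun x => ?_
  rw [abs_pow, ← mul_pow]
  exact pow_le_pow_left₀ (abs_nonneg _) (abs_real_inner_le_norm v x) k

theorem aux_inner_single (p : Fin n) (x : EuclideanSpace ℝ (Fin n)) :
    inner ℝ (EuclideanSpace.single p (1:ℝ)) x = x p := by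
  simp [EuclideanSpace.inner_single_left]

theorem aux_second (hn : 0 < n) (g : ℝ → ℝ) (hg : Continuous g)
    (hi : Integrable fun x : EuclideanSpace ℝ (Fin n) => g ‖x‖ * ‖x‖ ^ 2)
    (v : EuclideanSpace ℝ (Fin n)) :
    ∫ x : EuclideanSpace ℝ (Fin n), g ‖x‖ * (inner ℝ v x) ^ 2
      = ‖v‖ ^ 2 / n * ∫ x : EuclideanSpace ℝ (Fin n), g ‖x‖ * ‖x‖ ^ 2 := by
  set e : EuclideanSpace ℝ (Fin n) := EuclideanSpace.single ⟨0, hn⟩ 1 with he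
  have he1 : ‖e‖ = 1 := by simp [he]
  have key : ∫ x : EuclideanSpace ℝ (Fin n), g ‖x‖ * ‖x‖ ^ 2
      = n * ∫ x : EuclideanSpace ℝ (Fin n), g ‖x‖ * (inner ℝ e x) ^ 2 := by
    have : (fun x : EuclideanSpace ℝ (Fin n) => g ‖x‖ * ‖x‖ ^ 2) = fun x => ∑ p : Fin n,
        g ‖x‖ * (inner ℝ (EuclideanSpace.single p (1:ℝ)) x) ^ 2 := by
      ext x
      simp only [aux_inner_single]
      rw [← Finset.mul_sum, EuclideanSpace.real_norm_sq_eq]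
    rw [this, integral_finsetSum _ fun p _ => aux_int_inner g hg 2 hi _]
    have h2 : ∀ p : Fin n, ∫ x : EuclideanSpace ℝ (Fin n),
        g ‖x‖ * (inner ℝ (EuclideanSpace.single p (1:ℝ)) x) ^ 2 =
        ∫ x : EuclideanSpace ℝ (Fin n), g ‖x‖ * (inner ℝ e x) ^ 2 := fun p =>
      aux_rot g 2 _ _ (by simp [he])
    simp only [h2]
    simp
  have hn0 : (n : ℝ) ≠ 0 := by positivity
  rw [key, aux_hom g 2 e v he1]
  field_simp

theorem aux_int4 (g : ℝ → ℝ) (hg : Continuous g)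
    (hi : Integrable fun x : EuclideanSpace ℝ (Fin n) => g ‖x‖ * ‖x‖ ^ 4)
    (a b c d : EuclideanSpace ℝ (Fin n)) :
    Integrable fun x : EuclideanSpace ℝ (Fin n) =>
      g ‖x‖ * (inner ℝ a x * inner ℝ b x * inner ℝ c x * inner ℝ d x) := by
  refine aux_int g hg 4 hi _ (by fun_prop) (‖a‖ * ‖b‖ * ‖c‖ * ‖d‖) fun x => ?_
  rw [abs_mul, abs_mul, abs_mul]
  calc _ ≤ (‖a‖ * ‖x‖) * (‖b‖ * ‖x‖) * (‖c‖ * ‖x‖) * (‖d‖ * ‖x‖) := by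
        gcongr <;> exact abs_real_inner_le_norm _ _
    _ = _ := by ring

theorem aux_pol (g : ℝ → ℝ) (hg : Continuous g)
    (hi : Integrable fun x : EuclideanSpace ℝ (Fin n) => g ‖x‖ * ‖x‖ ^ 4)
    (e : EuclideanSpace ℝ (Fin n)) (he : ‖e‖ = 1)
    (a b c d : EuclideanSpace ℝ (Fin n)) :
    ∫ x : EuclideanSpace ℝ (Fin n),
      g ‖x‖ * (inner ℝ a x * inner ℝ b x * inner ℝ c x * inner ℝ d x)
      = (inner ℝ a b * inner ℝ c d + inner ℝ a c * inner ℝ b d + inner ℝ a d * inner ℝ b c) / 3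
        * ∫ x : EuclideanSpace ℝ (Fin n), g ‖x‖ * (inner ℝ e x) ^ 4 := by
  have I := aux_int_inner g hg 4 hi
  have hfun : (fun x : EuclideanSpace ℝ (Fin n) =>
      g ‖x‖ * (inner ℝ a x * inner ℝ b x * inner ℝ c x * inner ℝ d x)) = fun x =>
      (1 / 192 : ℝ) * ((g ‖x‖ * (inner ℝ (a + b + c + d) x) ^ 4
        + g ‖x‖ * (inner ℝ (a + b - c - d) x) ^ 4
        + g ‖x‖ * (inner ℝ (a - b + c - d) x) ^ 4
        + g ‖x‖ * (inner ℝ (a - b - c + d) x) ^ 4)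
        - (g ‖x‖ * (inner ℝ (a - b + c + d) x) ^ 4
        + g ‖x‖ * (inner ℝ (a + b - c + d) x) ^ 4
        + g ‖x‖ * (inner ℝ (a + b + c - d) x) ^ 4
        + g ‖x‖ * (inner ℝ (a - b - c - d) x) ^ 4)) := by
    ext x
    simp only [inner_add_left, inner_sub_left]
    ring
  rw [hfun, integral_const_mul, integral_sub, integral_add, integral_add, integral_add,
    integral_add, integral_add, integral_add]
  · have hA := fun v => aux_hom g 4 e v he
    generalize (∫ x : EuclideanSpace ℝ (Fin n), g ‖x‖ * (inner ℝ e x) ^ 4) = J at hA ⊢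
    simp only [hA]
    have h4 : ∀ v : EuclideanSpace ℝ (Fin n), ‖v‖ ^ 4 = (inner ℝ v v) ^ 2 := fun v => by
      rw [real_inner_self_eq_norm_sq]; ring
    simp only [h4, inner_add_left, inner_sub_left, inner_add_right, inner_sub_right]
    rw [real_inner_comm a b, real_inner_comm a c, real_inner_comm a d, real_inner_comm b c,
      real_inner_comm b d, real_inner_comm c d]
    ring
  all_goals first
    | exact I _
    | exact (I _).add (I _)
    | exact ((I _).add (I _)).add (I _)
    | exact (((I _).add (I _)).add (I _)).add (I _)

theorem aux_fourth (hn : 0 < n) (g : ℝ → ℝ) (hg : Continuous g)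
    (hi : Integrable fun x : EuclideanSpace ℝ (Fin n) => g ‖x‖ * ‖x‖ ^ 4)
    (p q r s : Fin n) :
    ∫ x : EuclideanSpace ℝ (Fin n), g ‖x‖ * (x p * x q * x r * x s)
      = ((if p = q then 1 else 0) * (if r = s then 1 else 0)
        + (if p = r then 1 else 0) * (if q = s then 1 else 0)
        + (if p = s then 1 else 0) * (if q = r then 1 else 0)) / (n * (n + 2) : ℝ)
        * ∫ x : EuclideanSpace ℝ (Fin n), g ‖x‖ * ‖x‖ ^ 4 := by
  set e : EuclideanSpace ℝ (Fin n) := EuclideanSpace.single ⟨0, hn⟩ 1 with he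
  have he1 : ‖e‖ = 1 := by simp [he]
  have P := fun p q r s : Fin n => aux_pol g hg hi e he1 (EuclideanSpace.single p 1)
    (EuclideanSpace.single q 1) (EuclideanSpace.single r 1) (EuclideanSpace.single s 1)
  have I := fun p q r s : Fin n => aux_int4 g hg hi (EuclideanSpace.single p 1)
    (EuclideanSpace.single q 1) (EuclideanSpace.single r 1) (EuclideanSpace.single s 1)
  have hss : ∀ p q : Fin n, inner ℝ (EuclideanSpace.single p (1:ℝ))
      (EuclideanSpace.single q (1:ℝ)) = if p = q then (1:ℝ) else 0 := fun p q => by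
    rw [aux_inner_single]; simp
  simp only [hss] at P
  simp only [aux_inner_single] at P I
  have key : ∫ x : EuclideanSpace ℝ (Fin n), g ‖x‖ * ‖x‖ ^ 4
      = (n * (n + 2) / 3 : ℝ) * ∫ x : EuclideanSpace ℝ (Fin n), g ‖x‖ * (inner ℝ e x) ^ 4 := by
    have : (fun x : EuclideanSpace ℝ (Fin n) => g ‖x‖ * ‖x‖ ^ 4) = fun x => ∑ p : Fin n,
        ∑ q : Fin n, g ‖x‖ * (x p * x p * x q * x q) := by
      ext x
      have : ‖x‖ ^ 4 = (∑ i, x i ^ 2) * (∑ i, x i ^ 2) := by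
        rw [← EuclideanSpace.real_norm_sq_eq]; ring
      rw [this, Finset.sum_mul_sum, Finset.mul_sum]
      refine Finset.sum_congr rfl fun p _ => ?_
      rw [Finset.mul_sum]
      refine Finset.sum_congr rfl fun q _ => ?_
      ring
    rw [this, integral_finsetSum _ fun p _ => integrable_finsetSum _ fun q _ => I p p q q]
    simp only [integral_finsetSum _ fun q _ => I _ _ q q, P, ← Finset.sum_mul]
    congr 1
    rw [show (n * (n + 2) / 3 : ℝ) = ∑ p : Fin n, ((n + 2) / 3 : ℝ) by simp; ring]
    refine Finset.sum_congr rfl fun p _ => ?_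
    rw [← Finset.sum_div, Finset.sum_add_distrib, Finset.sum_add_distrib]
    simp
    ring
  have hn0 : (n : ℝ) ≠ 0 := by positivity
  rw [key, P]
  field_simp

theorem aux_quad (hn : 0 < n) (g : ℝ → ℝ) (hg : Continuous g)
    (hi : Integrable fun x : EuclideanSpace ℝ (Fin n) => g ‖x‖ * ‖x‖ ^ 4)
    (B : Fin n → Fin n → ℝ) (htr : ∑ p, B p p = 0) :
    (Integrable fun x : EuclideanSpace ℝ (Fin n) =>
      g ‖x‖ * (∑ p, ∑ q, B p q * x p * x q) ^ 2) ∧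
    ∫ x : EuclideanSpace ℝ (Fin n), g ‖x‖ * (∑ p, ∑ q, B p q * x p * x q) ^ 2
      = (∑ p, ∑ q, (B p q + B q p) ^ 2) / 2 / (n * (n + 2) : ℝ)
        * ∫ x : EuclideanSpace ℝ (Fin n), g ‖x‖ * ‖x‖ ^ 4 := by
  have I : ∀ p q r s : Fin n, Integrable fun x : EuclideanSpace ℝ (Fin n) =>
      B p q * B r s * (g ‖x‖ * (x p * x q * x r * x s)) := fun p q r s => by
    have := aux_int4 g hg hi (EuclideanSpace.single p 1)
      (EuclideanSpace.single q 1) (EuclideanSpace.single r 1) (EuclideanSpace.single s 1)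
    simp only [aux_inner_single] at this
    exact this.const_mul _
  have hfun : (fun x : EuclideanSpace ℝ (Fin n) =>
      g ‖x‖ * (∑ p, ∑ q, B p q * x p * x q) ^ 2) = fun x => ∑ p, ∑ q, ∑ r, ∑ s,
        B p q * B r s * (g ‖x‖ * (x p * x q * x r * x s)) := by
    ext x
    rw [sq, Finset.sum_mul, Finset.mul_sum]
    refine Finset.sum_congr rfl fun p _ => ?_
    rw [Finset.sum_mul, Finset.mul_sum]
    refine Finset.sum_congr rfl fun q _ => ?_
    rw [Finset.mul_sum, Finset.mul_sum]
    refine Finset.sum_congr rfl fun r _ => ?_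
    rw [Finset.mul_sum, Finset.mul_sum]
    refine Finset.sum_congr rfl fun s _ => ?_
    ring
  have I1 := fun p q r => integrable_finsetSum Finset.univ fun s _ => I p q r s
  have I2 := fun p q => integrable_finsetSum Finset.univ fun r _ => I1 p q r
  have I3 := fun p => integrable_finsetSum Finset.univ fun q _ => I2 p q
  rw [hfun]
  refine ⟨integrable_finsetSum Finset.univ fun p _ => I3 p, ?_⟩
  rw [integral_finsetSum _ fun p _ => I3 p]
  simp only [integral_finsetSum _ fun q _ => I2 _ q, integral_finsetSum _ fun r _ => I1 _ _ r,
    integral_finsetSum _ fun s _ => I _ _ _ s, integral_const_mul, aux_fourth hn g hg hi]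
  set J := ∫ x : EuclideanSpace ℝ (Fin n), g ‖x‖ * ‖x‖ ^ 4
  set N : ℝ := n * (n + 2)
  have hterm : ∀ p q r s : Fin n, B p q * B r s * (((if p = q then 1 else 0) * (if r = s then 1 else 0)
        + (if p = r then 1 else 0) * (if q = s then 1 else 0)
        + (if p = s then 1 else 0) * (if q = r then 1 else 0)) / N * J)
      = (((if p = q then B p q else 0) * (if r = s then B r s else 0)
        + (if p = r then (if q = s then B p q * B r s else 0) else 0)
        + (if q = r then (if p = s then B p q * B r s else 0) else 0)) / N) * J := by
    intro p q r s
    split_ifs <;> ring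
  simp only [hterm, ← Finset.sum_mul, ← Finset.sum_div, Finset.sum_add_distrib, ← Finset.mul_sum]
  congr 2
  have hsq : ∑ p, ∑ q, (B p q + B q p) ^ 2 = 2 * (∑ p, ∑ q, B p q * B p q) +
      2 * ∑ p, ∑ q, B p q * B q p := by
    have hc : ∑ p, ∑ q, B q p * B q p = ∑ p, ∑ q, B p q * B p q := Finset.sum_comm
    calc _ = ∑ p, ∑ q, (B p q * B p q + 2 * (B p q * B q p) + B q p * B q p) := by
          refine Finset.sum_congr rfl fun p _ => Finset.sum_congr rfl fun q _ => by ring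
      _ = _ := by
          simp only [Finset.sum_add_distrib, hc, ← Finset.mul_sum]; ring
  rw [hsq]
  simp [htr]
  ring

end moments

theorem aux_pder (n : ℕ) (W : Fin n → Fin n → Fin n → Fin n → ℝ) (τ : ℝ) (i k l : Fin n)
    (x : EuclideanSpace ℝ (Fin n)) :
    pder n l (Hbar n W τ i k) x = fpoly τ (‖x‖ ^ 2) * (∑ q, (W i l k q + W i q k l) * x q)
      + 2 * x l * deriv (fpoly τ) (‖x‖ ^ 2) * Hten n W i k x := by
  have hx : ∀ p : Fin n, HasFDerivAt (fun y : EuclideanSpace ℝ (Fin n) => y p)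
      (EuclideanSpace.proj p : EuclideanSpace ℝ (Fin n) →L[ℝ] ℝ) x := fun p =>
    (EuclideanSpace.proj p : EuclideanSpace ℝ (Fin n) →L[ℝ] ℝ).hasFDerivAt
  have hH : HasFDerivAt (Hten n W i k) (∑ p, ∑ q, (W i p k q * x p) • (EuclideanSpace.proj q :
      EuclideanSpace ℝ (Fin n) →L[ℝ] ℝ) + ∑ p, ∑ q, (W i p k q * x q) • (EuclideanSpace.proj p :
      EuclideanSpace ℝ (Fin n) →L[ℝ] ℝ)) x := by
    unfold Hten
    have := HasFDerivAt.fun_sum (u := Finset.univ) fun p (_ : p ∈ Finset.univ) =>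
      HasFDerivAt.fun_sum (u := Finset.univ) fun q (_ : q ∈ Finset.univ) =>
        ((hx p).const_mul (W i p k q)).mul (hx q)
    refine this.congr_fderiv ?_
    simp only [Finset.sum_add_distrib]
    congr 1
    refine Finset.sum_congr rfl fun p _ => Finset.sum_congr rfl fun q _ => ?_
    rw [smul_smul, mul_comm]
  have hf : HasFDerivAt (fun y : EuclideanSpace ℝ (Fin n) => fpoly τ (‖y‖ ^ 2))
      (deriv (fpoly τ) (‖x‖ ^ 2) • (2 • innerSL ℝ x)) x := by
    have h0 := aux_hasDeriv_fpoly τ (‖x‖ ^ 2)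
    have h1 := (hasStrictFDerivAt_norm_sq x).hasFDerivAt
    exact HasDerivAt.comp_hasFDerivAt (f := fun y : EuclideanSpace ℝ (Fin n) => ‖y‖ ^ 2) x h0 h1
  have := (hf.mul hH).fderiv
  unfold pder
  have h2 : Hbar n W τ i k = fun y => fpoly τ (‖y‖ ^ 2) * Hten n W i k y := rfl
  rw [h2]
  erw [this]
  simp [EuclideanSpace.inner_single_right, Finset.sum_add_distrib, add_mul]
  ring

theorem aux_sum (n : ℕ) (W : Fin n → Fin n → Fin n → Fin n → ℝ) (τ : ℝ)
    (x : EuclideanSpace ℝ (Fin n)) :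
    ∑ i, ∑ k, ∑ l, (pder n l (Hbar n W τ i k) x) ^ 2
      = fpoly τ (‖x‖ ^ 2) ^ 2 * (∑ i, ∑ k, ∑ l, (∑ q, (W i l k q + W i q k l) * x q) ^ 2)
      + (8 * fpoly τ (‖x‖ ^ 2) * deriv (fpoly τ) (‖x‖ ^ 2)
        + 4 * ‖x‖ ^ 2 * deriv (fpoly τ) (‖x‖ ^ 2) ^ 2) * (∑ i, ∑ k, Hten n W i k x ^ 2) := by
  simp only [Finset.mul_sum, ← Finset.sum_add_distrib]
  refine Finset.sum_congr rfl fun i _ => Finset.sum_congr rfl fun k _ => ?_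
  have hD : ∑ l, x l * (∑ q, (W i l k q + W i q k l) * x q) = 2 * Hten n W i k x := by
    have h1 : ∑ l, x l * (∑ q, (W i l k q + W i q k l) * x q) =
        (∑ l, ∑ q, W i l k q * x l * x q) + ∑ l, ∑ q, W i q k l * x q * x l := by
      rw [← Finset.sum_add_distrib]
      refine Finset.sum_congr rfl fun l _ => ?_
      rw [← Finset.sum_add_distrib, Finset.mul_sum]
      refine Finset.sum_congr rfl fun q _ => ?_
      ring
    rw [h1, Finset.sum_comm (f := fun l q => W i q k l * x q * x l)]
    unfold Hten
    ring
  have hN : ∑ l, x l ^ 2 = ‖x‖ ^ 2 := (EuclideanSpace.real_norm_sq_eq x).symm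
  simp only [aux_pder]
  set F := fpoly τ (‖x‖ ^ 2)
  set dF := deriv (fpoly τ) (‖x‖ ^ 2)
  set H := Hten n W i k x
  set D : Fin n → ℝ := fun l => ∑ q, (W i l k q + W i q k l) * x q with hDdef
  change ∑ l, x l * D l = _ at hD
  change ∑ l, (F * D l + 2 * x l * dF * H) ^ 2 = ∑ l, F ^ 2 * D l ^ 2 + _
  calc ∑ l, (F * D l + 2 * x l * dF * H) ^ 2
      = ∑ l, (F ^ 2 * D l ^ 2 + 4 * F * dF * H * (x l * D l) + 4 * dF ^ 2 * H ^ 2 * x l ^ 2) :=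
        Finset.sum_congr rfl fun l _ => by ring
    _ = _ := by
        rw [Finset.sum_add_distrib, Finset.sum_add_distrib, ← Finset.mul_sum, ← Finset.mul_sum,
          ← Finset.mul_sum, hD, hN]
        ring

theorem aux_polar (n : ℕ) (hn : 0 < n) (g : ℝ → ℝ) :
    ∫ x : EuclideanSpace ℝ (Fin n), g ‖x‖
      = sphereArea n * ∫ r in Set.Ioi (0 : ℝ), r ^ (n - 1) * g r := by
  have : Nonempty (Fin n) := ⟨⟨0, hn⟩⟩
  rw [integral_fun_norm_addHaar volume g]
  have h : sphereArea n = n * (volume : Measure (EuclideanSpace ℝ (Fin n))).real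
      (Metric.ball 0 1) := by
    have := (volume : Measure (EuclideanSpace ℝ (Fin n))).toSphere_real_apply_univ
    rw [finrank_euclideanSpace_fin] at this
    exact this
  rw [h]
  simp [mul_assoc]

theorem stmt_10 (n : ℕ) (hn : 19 ≤ n) (W : Fin n → Fin n → Fin n → Fin n → ℝ)
    (hsymm1 : ∀ i j k l, W i j k l = - W j i k l)
    (hsymm2 : ∀ i j k l, W i j k l = - W i j l k)
    (hsymm3 : ∀ i j k l, W i j k l = W k l i j)
    (hBianchi : ∀ i j k l, W i j k l + W i k l j + W i l j k = 0)
    (htrace : ∀ j l, ∑ i, W i j i l = 0)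
    (τ : ℝ) (ε : ℝ) (hε : 0 < ε) :
    Integrable (fun x : EuclideanSpace ℝ (Fin n) =>
        ε ^ (n - 2) * (ε ^ 2 + ‖x‖ ^ 2) ^ ((2 : ℝ) - n) *
          ∑ i, ∑ k, ∑ l, (pder n l (Hbar n W τ i k) x) ^ 2) ∧
    IntegrableOn (fun r : ℝ =>
        ε ^ (n - 2) * (ε ^ 2 + r ^ 2) ^ ((2 : ℝ) - n) * r ^ (n + 1) *
          (((n : ℝ) + 2) * fpoly τ (r ^ 2) ^ 2
            + 4 * r ^ 2 * fpoly τ (r ^ 2) * deriv (fpoly τ) (r ^ 2)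
            + 2 * r ^ 4 * (deriv (fpoly τ) (r ^ 2)) ^ 2))
      (Set.Ioi (0 : ℝ)) ∧
    ∫ x : EuclideanSpace ℝ (Fin n),
        ε ^ (n - 2) * (ε ^ 2 + ‖x‖ ^ 2) ^ ((2 : ℝ) - n) *
          ∑ i, ∑ k, ∑ l, (pder n l (Hbar n W τ i k) x) ^ 2
      = 1 / ((n : ℝ) * ((n : ℝ) + 2)) * sphereArea n *
          (∑ i, ∑ j, ∑ k, ∑ l, (W i j k l + W i l k j) ^ 2) *
          ∫ r in Set.Ioi (0 : ℝ),
            ε ^ (n - 2) * (ε ^ 2 + r ^ 2) ^ ((2 : ℝ) - n) * r ^ (n + 1) *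
              (((n : ℝ) + 2) * fpoly τ (r ^ 2) ^ 2
                + 4 * r ^ 2 * fpoly τ (r ^ 2) * deriv (fpoly τ) (r ^ 2)
                + 2 * r ^ 4 * (deriv (fpoly τ) (r ^ 2)) ^ 2) := by
  have hn0 : 0 < n := by omega
  have : Nonempty (Fin n) := ⟨⟨0, hn0⟩⟩
  have hnR : (n : ℝ) ≠ 0 := by positivity
  set w : ℝ → ℝ := fun r => ε ^ (n - 2) * (ε ^ 2 + r ^ 2) ^ ((2 : ℝ) - n) with hw
  have hwc : Continuous w := by
    refine Continuous.mul continuous_const (Continuous.rpow_const (by fun_prop) fun r => Or.inl ?_)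
    positivity
  have hd : ∀ s, deriv (fpoly τ) s = 5 - 2 * s + 3 * s ^ 2 / 20 := aux_deriv_fpoly τ
  set G2 : ℝ → ℝ := fun r => w r * fpoly τ (r ^ 2) ^ 2 with hG2
  set G4 : ℝ → ℝ := fun r => w r * (8 * fpoly τ (r ^ 2) * deriv (fpoly τ) (r ^ 2)
        + 4 * r ^ 2 * deriv (fpoly τ) (r ^ 2) ^ 2) with hG4
  have hG2c : Continuous G2 := by
    refine hwc.mul ?_
    unfold fpoly
    fun_prop
  have hG4c : Continuous G4 := by
    refine hwc.mul ?_
    simp only [hd]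
    unfold fpoly
    fun_prop
  -- radial integrability
  have hp2 : ∀ r : ℝ, r ^ (n - 1) * (G2 r * r ^ 2) = w r * r ^ (n + 1) * fpoly τ (r ^ 2) ^ 2 := by
    intro r
    rw [show n + 1 = (n - 1) + 2 by omega, pow_add]
    simp only [hG2]; ring
  have hp4 : ∀ r : ℝ, r ^ (n - 1) * (G4 r * r ^ 4) = w r * r ^ (n + 1) *
      (8 * r ^ 2 * fpoly τ (r ^ 2) * deriv (fpoly τ) (r ^ 2)
        + 4 * r ^ 4 * deriv (fpoly τ) (r ^ 2) ^ 2) := by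
    intro r
    rw [show n + 1 = (n - 1) + 2 by omega, pow_add]
    simp only [hG4]; ring
  have hR2 : IntegrableOn (fun r : ℝ => r ^ (n - 1) * (G2 r * r ^ 2)) (Set.Ioi 0) := by
    simp only [hp2]
    refine (aux_poly n hn ε hε ((Polynomial.C τ + Polynomial.C 5 * Polynomial.X ^ 2
      - Polynomial.X ^ 4 + Polynomial.C (1 / 20) * Polynomial.X ^ 6) ^ 2) ?_).congr_fun ?_
      measurableSet_Ioi
    · compute_degree
    · intro r _
      simp only [hw, fpoly, Polynomial.eval_pow, Polynomial.eval_add, Polynomial.eval_sub,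
        Polynomial.eval_mul, Polynomial.eval_C, Polynomial.eval_X]
      ring
  have hR4 : IntegrableOn (fun r : ℝ => r ^ (n - 1) * (G4 r * r ^ 4)) (Set.Ioi 0) := by
    simp only [hp4, hd]
    refine (aux_poly n hn ε hε (Polynomial.C 8 * Polynomial.X ^ 2 *
      (Polynomial.C τ + Polynomial.C 5 * Polynomial.X ^ 2
      - Polynomial.X ^ 4 + Polynomial.C (1 / 20) * Polynomial.X ^ 6) *
      (Polynomial.C 5 - Polynomial.C 2 * Polynomial.X ^ 2
        + Polynomial.C (3 / 20) * Polynomial.X ^ 4) + Polynomial.C 4 * Polynomial.X ^ 4 *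
      (Polynomial.C 5 - Polynomial.C 2 * Polynomial.X ^ 2
        + Polynomial.C (3 / 20) * Polynomial.X ^ 4) ^ 2) ?_).congr_fun ?_
      measurableSet_Ioi
    · compute_degree
    · intro r _
      simp only [hw, fpoly, Polynomial.eval_pow, Polynomial.eval_add, Polynomial.eval_sub,
        Polynomial.eval_mul, Polynomial.eval_C, Polynomial.eval_X]
      ring
  have hI2 : Integrable fun x : EuclideanSpace ℝ (Fin n) => G2 ‖x‖ * ‖x‖ ^ 2 := by
    refine (integrable_fun_norm_addHaar volume (f := fun r => G2 r * r ^ 2)).2 ?_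
    simpa using hR2
  have hI4 : Integrable fun x : EuclideanSpace ℝ (Fin n) => G4 ‖x‖ * ‖x‖ ^ 4 := by
    refine (integrable_fun_norm_addHaar volume (f := fun r => G4 r * r ^ 4)).2 ?_
    simpa using hR4
  have hJ2 := aux_polar n hn0 (fun r => G2 r * r ^ 2)
  have hJ4 := aux_polar n hn0 (fun r => G4 r * r ^ 4)
  -- the radial integrand
  have hrad : ∀ r : ℝ, w r * r ^ (n + 1) * (((n : ℝ) + 2) * fpoly τ (r ^ 2) ^ 2
            + 4 * r ^ 2 * fpoly τ (r ^ 2) * deriv (fpoly τ) (r ^ 2)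
            + 2 * r ^ 4 * (deriv (fpoly τ) (r ^ 2)) ^ 2)
      = ((n : ℝ) + 2) * (r ^ (n - 1) * (G2 r * r ^ 2))
        + (1 / 2) * (r ^ (n - 1) * (G4 r * r ^ 4)) := by
    intro r
    rw [hp2, hp4]; ring
  -- the quadratic pieces
  set a : Fin n → Fin n → Fin n → EuclideanSpace ℝ (Fin n) := fun i k l =>
    WithLp.toLp 2 fun q => W i l k q + W i q k l with ha
  have hin : ∀ i k l (x : EuclideanSpace ℝ (Fin n)),
      ∑ q, (W i l k q + W i q k l) * x q = inner ℝ (a i k l) x := by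
    intro i k l x
    simp [ha, PiLp.inner_apply, mul_comm]
  have hna : ∀ i k l, ‖a i k l‖ ^ 2 = ∑ q, (W i l k q + W i q k l) ^ 2 := by
    intro i k l
    rw [EuclideanSpace.real_norm_sq_eq]
  have hfun : (fun x : EuclideanSpace ℝ (Fin n) => w ‖x‖ *
      ∑ i, ∑ k, ∑ l, (pder n l (Hbar n W τ i k) x) ^ 2) = fun x =>
      (∑ i, ∑ k, ∑ l, G2 ‖x‖ * (inner ℝ (a i k l) x) ^ 2)
      + ∑ i, ∑ k, G4 ‖x‖ * (∑ p, ∑ q, W i p k q * x p * x q) ^ 2 := by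
    ext x
    rw [aux_sum]
    simp only [hin, ← Finset.mul_sum, hG2, hG4, Hten]
    ring
  have htr : ∀ i k, ∑ p, W i p k p = 0 := by
    intro i k
    rw [← htrace i k]
    refine Finset.sum_congr rfl fun p _ => ?_
    rw [hsymm1, hsymm2, neg_neg]
  have A1 := fun i k l => aux_int_inner G2 hG2c 2 hI2 (a i k l)
  have A2 := fun i k => integrable_finsetSum Finset.univ fun l _ => A1 i k l
  have A3 := fun i => integrable_finsetSum Finset.univ fun k _ => A2 i k
  have A4 := integrable_finsetSum Finset.univ fun i _ => A3 i
  have B0 := fun i k => aux_quad hn0 G4 hG4c hI4 (fun p q => W i p k q) (htr i k)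
  have B1 := fun i k => (B0 i k).1
  have B2 := fun i => integrable_finsetSum Finset.univ fun k _ => B1 i k
  have B3 := integrable_finsetSum Finset.univ fun i _ => B2 i
  have hQ : ∑ i, ∑ j, ∑ k, ∑ l, (W i j k l + W i l k j) ^ 2
      = ∑ i, ∑ k, ∑ j, ∑ l, (W i j k l + W i l k j) ^ 2 :=
    Finset.sum_congr rfl fun i _ => Finset.sum_comm
  change Integrable (fun x : EuclideanSpace ℝ (Fin n) => w ‖x‖ *
      ∑ i, ∑ k, ∑ l, (pder n l (Hbar n W τ i k) x) ^ 2) ∧ IntegrableOn (fun r : ℝ =>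
        w r * r ^ (n + 1) * (((n : ℝ) + 2) * fpoly τ (r ^ 2) ^ 2
            + 4 * r ^ 2 * fpoly τ (r ^ 2) * deriv (fpoly τ) (r ^ 2)
            + 2 * r ^ 4 * (deriv (fpoly τ) (r ^ 2)) ^ 2)) (Set.Ioi (0 : ℝ)) ∧
     ∫ x : EuclideanSpace ℝ (Fin n), w ‖x‖ *
      ∑ i, ∑ k, ∑ l, (pder n l (Hbar n W τ i k) x) ^ 2 =
      1 / ((n : ℝ) * ((n : ℝ) + 2)) * sphereArea n *
          (∑ i, ∑ j, ∑ k, ∑ l, (W i j k l + W i l k j) ^ 2) *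
          ∫ r in Set.Ioi (0 : ℝ), w r * r ^ (n + 1) * (((n : ℝ) + 2) * fpoly τ (r ^ 2) ^ 2
            + 4 * r ^ 2 * fpoly τ (r ^ 2) * deriv (fpoly τ) (r ^ 2)
            + 2 * r ^ 4 * (deriv (fpoly τ) (r ^ 2)) ^ 2)
  simp only [hrad]
  rw [hfun]
  refine ⟨A4.add B3, (hR2.const_mul _).add (hR4.const_mul _), ?_⟩
  rw [integral_add A4 B3, integral_add (hR2.const_mul _) (hR4.const_mul _), integral_const_mul,
    integral_const_mul, integral_finsetSum _ fun i _ => A3 i, integral_finsetSum _ fun i _ => B2 i]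
  simp only [integral_finsetSum _ fun k _ => A2 _ k, integral_finsetSum _ fun l _ => A1 _ _ l,
    integral_finsetSum _ fun k _ => B1 _ k, (B0 _ _).2, aux_second hn0 G2 hG2c hI2, hna]
  simp only [← Finset.sum_mul, ← Finset.sum_div]
  rw [hJ2, hJ4, hQ]
  generalize ∑ i, ∑ k, ∑ j, ∑ l, (W i j k l + W i l k j) ^ 2 = Q
  have hn2 : (n : ℝ) + 2 ≠ 0 := by positivity
  field_simp
end

section
/- For every r > 0 and all indices p, q ∈ {1,…,n}: ∫_{∂B_r(0)} Σ_{l=1}^n H̄_{pl}(x) H̄_{ql}(x) dσ(x) = (1/(2n(n+2))) |S^{n−1}| Σ_{i,k,l=1}^n (W_{ipkl} + W_{ilkp})(W_{iqkl} + W_{ilkq}) · r^{n+3} f(r²)². -/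
open scoped BigOperators
open MeasureTheory

/-- Integrals over the unit sphere are invariant under linear isometries. -/
lemma sphere_integral_isometry {n : ℕ}
    (U : EuclideanSpace ℝ (Fin n) ≃ₗᵢ[ℝ] EuclideanSpace ℝ (Fin n))
    (g : EuclideanSpace ℝ (Fin n) → ℝ) (hg : Continuous g) :
    ∫ ω : Metric.sphere (0 : EuclideanSpace ℝ (Fin n)) 1, g (U ω)
        ∂(volume : Measure (EuclideanSpace ℝ (Fin n))).toSphere
      = ∫ ω : Metric.sphere (0 : EuclideanSpace ℝ (Fin n)) 1, g ω
        ∂(volume : Measure (EuclideanSpace ℝ (Fin n))).toSphere := by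
  let V : Metric.sphere (0 : EuclideanSpace ℝ (Fin n)) 1 →
      Metric.sphere (0 : EuclideanSpace ℝ (Fin n)) 1 := fun ω => ⟨U ω, by simp⟩
  have hVc : Continuous V := by
    apply Continuous.subtype_mk
    exact U.continuous.comp continuous_subtype_val
  have hmap : Measure.map V (volume : Measure (EuclideanSpace ℝ (Fin n))).toSphere
      = (volume : Measure (EuclideanSpace ℝ (Fin n))).toSphere := by
    ext s hs
    rw [Measure.map_apply hVc.measurable hs, Measure.toSphere_apply' _ hs,
      Measure.toSphere_apply' _ (hVc.measurable hs)]
    congr 1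
    conv_rhs =>
      rw [← U.measurePreserving.measure_preimage_emb U.toHomeomorph.measurableEmbedding]
    congr 1
    ext x
    simp only [Set.mem_smul, Set.mem_image, Set.mem_preimage]
    constructor
    · rintro ⟨t, ht, y, ⟨ω, hω, rfl⟩, rfl⟩
      exact ⟨t, ht, _, ⟨V ω, hω, rfl⟩, by simp [V]⟩
    · rintro ⟨t, ht, y, ⟨ω, hω, rfl⟩, hx⟩
      refine ⟨t, ht, U.symm ω, ⟨⟨U.symm ω, by simp⟩, ?_, rfl⟩, ?_⟩
      · simpa [V] using hω
      · apply U.injective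
        simp [hx]
  conv_rhs => rw [← hmap]
  rw [integral_map hVc.aemeasurable]
  exact (hg.comp continuous_subtype_val).aestronglyMeasurable

lemma sphere_integrable {n : ℕ} (g : Metric.sphere (0 : EuclideanSpace ℝ (Fin n)) 1 → ℝ)
    (hg : Continuous g) :
    Integrable g (volume : Measure (EuclideanSpace ℝ (Fin n))).toSphere := by
  exact hg.integrable_of_hasCompactSupport (HasCompactSupport.of_compactSpace g)

/-- The fourth power moment depends only on the norm. -/
lemma sphere_fourth {n : ℕ} (hn : 0 < n) : ∃ A : ℝ, ∀ y : EuclideanSpace ℝ (Fin n),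
    ∫ ω : Metric.sphere (0 : EuclideanSpace ℝ (Fin n)) 1,
        (inner ℝ (ω : EuclideanSpace ℝ (Fin n)) y) ^ 4
        ∂(volume : Measure (EuclideanSpace ℝ (Fin n))).toSphere
      = A * (inner ℝ y y) ^ 2 := by
  let e : EuclideanSpace ℝ (Fin n) := EuclideanSpace.single ⟨0, hn⟩ 1
  have he : ‖e‖ = 1 := by simp [e]
  refine ⟨∫ ω : Metric.sphere (0 : EuclideanSpace ℝ (Fin n)) 1,
        (inner ℝ (ω : EuclideanSpace ℝ (Fin n)) e) ^ 4
        ∂(volume : Measure (EuclideanSpace ℝ (Fin n))).toSphere, fun y => ?_⟩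
  have hU := Submodule.reflection_sub (v := ‖y‖ • e) (w := y) (by simp [norm_smul, he])
  set U := (Submodule.span ℝ {‖y‖ • e - y})ᗮ.reflection with hUdef
  rw [← sphere_integral_isometry U (fun x => (inner ℝ x y) ^ 4) (by fun_prop)]
  rw [← integral_mul_const]
  congr 1
  ext ω
  conv_lhs => rw [← hU, LinearIsometryEquiv.inner_map_map, inner_smul_right]
  rw [real_inner_self_eq_norm_sq]
  ring

lemma sphere_quartic {n : ℕ} (hn : 0 < n) : ∃ A : ℝ, ∀ a b c d : EuclideanSpace ℝ (Fin n),
    ∫ ω : Metric.sphere (0 : EuclideanSpace ℝ (Fin n)) 1,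
        (inner ℝ (ω : EuclideanSpace ℝ (Fin n)) a) * (inner ℝ (ω : EuclideanSpace ℝ (Fin n)) b)
        * (inner ℝ (ω : EuclideanSpace ℝ (Fin n)) c) * (inner ℝ (ω : EuclideanSpace ℝ (Fin n)) d)
        ∂(volume : Measure (EuclideanSpace ℝ (Fin n))).toSphere
      = A * (inner ℝ a b * inner ℝ c d + inner ℝ a c * inner ℝ b d
          + inner ℝ a d * inner ℝ b c) := by
  obtain ⟨A, hA⟩ := sphere_fourth hn
  refine ⟨A / 3, fun a b c d => ?_⟩
  have key : ∀ ω : Metric.sphere (0 : EuclideanSpace ℝ (Fin n)) 1,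
      (inner ℝ (ω : EuclideanSpace ℝ (Fin n)) a) * (inner ℝ (ω : EuclideanSpace ℝ (Fin n)) b)
        * (inner ℝ (ω : EuclideanSpace ℝ (Fin n)) c) * (inner ℝ (ω : EuclideanSpace ℝ (Fin n)) d)
      = (1 / 192) * ((inner ℝ (ω : EuclideanSpace ℝ (Fin n)) (a + b + c + d)) ^ 4
        - (inner ℝ (ω : EuclideanSpace ℝ (Fin n)) (a + b + c - d)) ^ 4
        - (inner ℝ (ω : EuclideanSpace ℝ (Fin n)) (a + b - c + d)) ^ 4
        - (inner ℝ (ω : EuclideanSpace ℝ (Fin n)) (a - b + c + d)) ^ 4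
        + (inner ℝ (ω : EuclideanSpace ℝ (Fin n)) (a + b - c - d)) ^ 4
        + (inner ℝ (ω : EuclideanSpace ℝ (Fin n)) (a - b + c - d)) ^ 4
        + (inner ℝ (ω : EuclideanSpace ℝ (Fin n)) (a - b - c + d)) ^ 4
        - (inner ℝ (ω : EuclideanSpace ℝ (Fin n)) (a - b - c - d)) ^ 4) := by
    intro ω
    simp only [inner_add_right, inner_sub_right]
    ring
  simp only [key]
  rw [integral_const_mul, integral_sub, integral_add, integral_add, integral_add, integral_sub,
    integral_sub, integral_sub]
  · simp only [hA]
    simp only [inner_add_right, inner_sub_right, inner_add_left, inner_sub_left,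
      real_inner_comm a b, real_inner_comm a c, real_inner_comm a d, real_inner_comm b c,
      real_inner_comm b d, real_inner_comm c d]
    ring
  all_goals exact sphere_integrable _ (by fun_prop)

lemma sphere_coord {n : ℕ} (hn : 0 < n) (a b c d : Fin n) :
    ∫ ω : Metric.sphere (0 : EuclideanSpace ℝ (Fin n)) 1,
        (ω : EuclideanSpace ℝ (Fin n)) a * (ω : EuclideanSpace ℝ (Fin n)) b
        * (ω : EuclideanSpace ℝ (Fin n)) c * (ω : EuclideanSpace ℝ (Fin n)) d
        ∂(volume : Measure (EuclideanSpace ℝ (Fin n))).toSphere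
      = sphereArea n / (n * (n + 2)) *
        ((if a = b then 1 else 0) * (if c = d then 1 else 0)
        + (if a = c then 1 else 0) * (if b = d then 1 else 0)
        + (if a = d then 1 else 0) * (if b = c then 1 else 0)) := by
  obtain ⟨A, hA⟩ := sphere_quartic hn
  have hA' : ∀ a b c d : Fin n, ∫ ω : Metric.sphere (0 : EuclideanSpace ℝ (Fin n)) 1,
        (ω : EuclideanSpace ℝ (Fin n)) a * (ω : EuclideanSpace ℝ (Fin n)) b
        * (ω : EuclideanSpace ℝ (Fin n)) c * (ω : EuclideanSpace ℝ (Fin n)) d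
        ∂(volume : Measure (EuclideanSpace ℝ (Fin n))).toSphere
      = A * ((if a = b then 1 else 0) * (if c = d then 1 else 0)
        + (if a = c then 1 else 0) * (if b = d then 1 else 0)
        + (if a = d then 1 else 0) * (if b = c then 1 else 0)) := by
    intro a b c d
    have := hA (EuclideanSpace.single a 1) (EuclideanSpace.single b 1)
      (EuclideanSpace.single c 1) (EuclideanSpace.single d 1)
    simpa [EuclideanSpace.inner_single_right, EuclideanSpace.inner_single_left, eq_comm,
      Pi.single_apply] using this
  have hsum : ∑ a : Fin n, ∑ c : Fin n, ∫ ω : Metric.sphere (0 : EuclideanSpace ℝ (Fin n)) 1,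
        (ω : EuclideanSpace ℝ (Fin n)) a * (ω : EuclideanSpace ℝ (Fin n)) a
        * (ω : EuclideanSpace ℝ (Fin n)) c * (ω : EuclideanSpace ℝ (Fin n)) c
        ∂(volume : Measure (EuclideanSpace ℝ (Fin n))).toSphere = sphereArea n := by
    have h1 : ∀ ω : Metric.sphere (0 : EuclideanSpace ℝ (Fin n)) 1,
        ∑ a : Fin n, ∑ c : Fin n, (ω : EuclideanSpace ℝ (Fin n)) a
          * (ω : EuclideanSpace ℝ (Fin n)) a
          * (ω : EuclideanSpace ℝ (Fin n)) c * (ω : EuclideanSpace ℝ (Fin n)) c = 1 := by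
      intro ω
      have h2 : ∑ a : Fin n, (ω : EuclideanSpace ℝ (Fin n)) a
          * (ω : EuclideanSpace ℝ (Fin n)) a = 1 := by
        have := EuclideanSpace.real_norm_sq_eq (ω : EuclideanSpace ℝ (Fin n))
        rw [norm_eq_of_mem_sphere] at this
        simpa [sq] using this.symm
      simp only [mul_assoc, ← Finset.mul_sum]
      simp only [← mul_assoc, ← Finset.sum_mul, h2]
      norm_num
    have h3 : ∀ a : Fin n, ∑ c : Fin n, ∫ ω : Metric.sphere (0 : EuclideanSpace ℝ (Fin n)) 1,
        (ω : EuclideanSpace ℝ (Fin n)) a * (ω : EuclideanSpace ℝ (Fin n)) a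
        * (ω : EuclideanSpace ℝ (Fin n)) c * (ω : EuclideanSpace ℝ (Fin n)) c
        ∂(volume : Measure (EuclideanSpace ℝ (Fin n))).toSphere
        = ∫ ω : Metric.sphere (0 : EuclideanSpace ℝ (Fin n)) 1, ∑ c : Fin n,
        (ω : EuclideanSpace ℝ (Fin n)) a * (ω : EuclideanSpace ℝ (Fin n)) a
        * (ω : EuclideanSpace ℝ (Fin n)) c * (ω : EuclideanSpace ℝ (Fin n)) c
        ∂(volume : Measure (EuclideanSpace ℝ (Fin n))).toSphere := by
      intro a
      rw [integral_finsetSum]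
      exact fun i _ => sphere_integrable _ (by fun_prop)
    simp only [h3]
    rw [← integral_finsetSum]
    swap
    · exact fun i _ => sphere_integrable _ (by fun_prop)
    simp only [h1]
    simp only [integral_const, smul_eq_mul, mul_one]
    rfl
  have hval : A * (n * (n + 2)) = sphereArea n := by
    rw [← hsum]
    simp only [hA', ← Finset.mul_sum]
    congr 1
    simp [Finset.sum_add_distrib]
    ring
  rw [hA', ← hval]
  have : (n : ℝ) ≠ 0 := by positivity
  field_simp

lemma sphere_HH {n : ℕ} (hn : 0 < n) (W : Fin n → Fin n → Fin n → Fin n → ℝ)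
    (hW : ∀ p l, ∑ a, W p a l a = 0) (p q : Fin n) :
    ∫ ω : Metric.sphere (0 : EuclideanSpace ℝ (Fin n)) 1,
        ∑ l, Hten n W p l ω * Hten n W q l ω
        ∂(volume : Measure (EuclideanSpace ℝ (Fin n))).toSphere
      = sphereArea n / (n * (n + 2)) *
        ∑ l, ∑ a, ∑ b, (W p a l b * W q a l b + W p a l b * W q b l a) := by
  have hexp : ∀ ω : EuclideanSpace ℝ (Fin n), ∑ l, Hten n W p l ω * Hten n W q l ω
      = ∑ l, ∑ a, ∑ b, ∑ c, ∑ d, (W p a l b * W q c l d) * (ω a * ω b * ω c * ω d) := by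
    intro ω
    refine Finset.sum_congr rfl fun l _ => ?_
    unfold Hten
    rw [Finset.sum_mul]
    refine Finset.sum_congr rfl fun a _ => ?_
    rw [Finset.sum_mul]
    refine Finset.sum_congr rfl fun b _ => ?_
    rw [Finset.mul_sum]
    refine Finset.sum_congr rfl fun c _ => ?_
    rw [Finset.mul_sum]
    refine Finset.sum_congr rfl fun d _ => ?_
    ring
  simp only [hexp]
  rw [integral_finsetSum _ (fun i _ => sphere_integrable _ (by fun_prop)), Finset.mul_sum]
  refine Finset.sum_congr rfl fun l _ => ?_
  have h1 : ∫ ω : Metric.sphere (0 : EuclideanSpace ℝ (Fin n)) 1,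
      ∑ a, ∑ b, ∑ c, ∑ d, (W p a l b * W q c l d) * ((ω : EuclideanSpace ℝ (Fin n)) a
        * (ω : EuclideanSpace ℝ (Fin n)) b * (ω : EuclideanSpace ℝ (Fin n)) c
        * (ω : EuclideanSpace ℝ (Fin n)) d)
        ∂(volume : Measure (EuclideanSpace ℝ (Fin n))).toSphere
      = ∑ a, ∑ b, ∑ c, ∑ d, (W p a l b * W q c l d) * (sphereArea n / (n * (n + 2)) *
        ((if a = b then 1 else 0) * (if c = d then 1 else 0)
        + (if a = c then 1 else 0) * (if b = d then 1 else 0)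
        + (if a = d then 1 else 0) * (if b = c then 1 else 0))) := by
    rw [integral_finsetSum _ (fun i _ => sphere_integrable _ (by fun_prop))]
    refine Finset.sum_congr rfl fun a _ => ?_
    rw [integral_finsetSum _ (fun i _ => sphere_integrable _ (by fun_prop))]
    refine Finset.sum_congr rfl fun b _ => ?_
    rw [integral_finsetSum _ (fun i _ => sphere_integrable _ (by fun_prop))]
    refine Finset.sum_congr rfl fun c _ => ?_
    rw [integral_finsetSum _ (fun i _ => sphere_integrable _ (by fun_prop))]
    refine Finset.sum_congr rfl fun d _ => ?_
    rw [integral_const_mul, sphere_coord hn]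
  rw [h1]
  have h2 : ∀ a b, ∑ c, ∑ d, (W p a l b * W q c l d) * (sphereArea n / (n * (n + 2)) *
        ((if a = b then 1 else 0) * (if c = d then 1 else 0)
        + (if a = c then 1 else 0) * (if b = d then 1 else 0)
        + (if a = d then 1 else 0) * (if b = c then 1 else 0)))
      = sphereArea n / (n * (n + 2)) * (W p a l b * W q a l b + W p a l b * W q b l a) := by
    intro a b
    generalize sphereArea n / ((n : ℝ) * (n + 2)) = K
    have e : ∀ c d, (W p a l b * W q c l d) * (K *
        ((if a = b then 1 else 0) * (if c = d then 1 else 0)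
        + (if a = c then 1 else 0) * (if b = d then 1 else 0)
        + (if a = d then 1 else 0) * (if b = c then 1 else 0)))
        = (K * W p a l b * (if a = b then 1 else 0)) * (if c = d then W q c l d else 0)
        + (if a = c then (if b = d then K * W p a l b * W q c l d else 0) else 0)
        + (if b = c then (if a = d then K * W p a l b * W q c l d else 0) else 0) := by
      intro c d
      split_ifs <;> ring
    simp only [e, Finset.sum_add_distrib, ← Finset.mul_sum]
    simp [hW]
    ring
  simp only [h2, ← Finset.mul_sum]

theorem stmt_14 (n : ℕ) (hn : 3 ≤ n) (W : Fin n → Fin n → Fin n → Fin n → ℝ)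
    (hsymm1 : ∀ i j k l, W i j k l = - W j i k l)
    (hsymm2 : ∀ i j k l, W i j k l = - W i j l k)
    (hsymm3 : ∀ i j k l, W i j k l = W k l i j)
    (hBianchi : ∀ i j k l, W i j k l + W i k l j + W i l j k = 0)
    (htrace : ∀ j l, ∑ i, W i j i l = 0)
    (τ : ℝ) (r : ℝ) (hr : 0 < r) (p q : Fin n) :
    ∫ x, ∑ l, Hbar n W τ p l x * Hbar n W τ q l x ∂(surfMeasure n r)
      = 1 / (2 * (n : ℝ) * ((n : ℝ) + 2)) * sphereArea n *
          (∑ i, ∑ k, ∑ l, (W i p k l + W i l k p) * (W i q k l + W i l k q)) *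
          (r ^ (n + 3) * fpoly τ (r ^ 2) ^ 2) := by
  have hn0 : 0 < n := by omega
  have hW : ∀ p l, ∑ a, W p a l a = 0 := by
    intro p l
    rw [← htrace p l]
    refine Finset.sum_congr rfl fun a _ => ?_
    rw [hsymm1, hsymm2, neg_neg]
  have hHc : ∀ i k, Continuous (Hten n W i k) := by
    intro i k
    unfold Hten
    fun_prop
  have hbc : ∀ i k, Continuous (Hbar n W τ i k) := by
    intro i k
    have := hHc i k
    unfold Hbar fpoly
    fun_prop
  have hscale : ∀ (ω : Metric.sphere (0 : EuclideanSpace ℝ (Fin n)) 1) (i k : Fin n),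
      Hbar n W τ i k (r • (ω : EuclideanSpace ℝ (Fin n)))
        = fpoly τ (r ^ 2) * r ^ 2 * Hten n W i k ω := by
    intro ω i k
    have hnorm : ‖r • (ω : EuclideanSpace ℝ (Fin n))‖ = r := by
      rw [norm_smul, norm_eq_of_mem_sphere, mul_one, Real.norm_of_nonneg hr.le]
    unfold Hbar
    rw [hnorm, mul_assoc]
    congr 1
    unfold Hten
    simp only [Finset.mul_sum]
    refine Finset.sum_congr rfl fun a _ => Finset.sum_congr rfl fun b _ => ?_
    simp only [PiLp.smul_apply, smul_eq_mul]
    ring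
  have hcomb : ∑ i, ∑ k, ∑ l, (W i p k l + W i l k p) * (W i q k l + W i l k q)
      = 2 * ∑ l, ∑ a, ∑ b, (W p a l b * W q a l b + W p a l b * W q b l a) := by
    have e1 : ∀ p i k l, W i p k l = W p i l k := fun p i k l => by
      rw [hsymm1, hsymm2, neg_neg]
    have e2 : ∀ p i k l, W i l k p = W p k l i := fun p i k l => by
      rw [hsymm3 i l k p, e1]
    have e3 : ∀ l, ∑ a, ∑ b, (W p a l b + W p b l a) * (W q a l b + W q b l a)
        = 2 * ∑ a, ∑ b, (W p a l b * W q a l b + W p a l b * W q b l a) := by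
      intro l
      have : ∑ a, ∑ b, (W p b l a * W q b l a + W p b l a * W q a l b)
        = ∑ a, ∑ b, (W p a l b * W q a l b + W p a l b * W q b l a) := Finset.sum_comm
      rw [two_mul]
      nth_rewrite 1 [← this]
      simp only [← Finset.sum_add_distrib]
      refine Finset.sum_congr rfl fun a _ => Finset.sum_congr rfl fun b _ => ?_
      ring
    rw [Finset.mul_sum]
    simp only [← e3]
    conv_rhs => rw [Finset.sum_comm]
    refine Finset.sum_congr rfl fun a _ => ?_
    rw [Finset.sum_comm]
    refine Finset.sum_congr rfl fun l _ => Finset.sum_congr rfl fun b _ => ?_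
    rw [e1 p, e2 p, e1 q, e2 q]
  rw [hcomb]
  unfold surfMeasure
  rw [integral_smul_measure, integral_map]
  · simp only [hscale]
    have h4 : ∀ ω : Metric.sphere (0 : EuclideanSpace ℝ (Fin n)) 1,
        ∑ l, fpoly τ (r ^ 2) * r ^ 2 * Hten n W p l ω * (fpoly τ (r ^ 2) * r ^ 2 * Hten n W q l ω)
        = (fpoly τ (r ^ 2) ^ 2 * r ^ 4) * ∑ l, Hten n W p l ω * Hten n W q l ω := by
      intro ω
      rw [Finset.mul_sum]
      refine Finset.sum_congr rfl fun l _ => ?_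
      ring
    simp only [h4]
    rw [integral_const_mul, sphere_HH hn0 W hW, ENNReal.toReal_ofReal (by positivity), smul_eq_mul]
    have hp : r ^ (n + 3) = r ^ (n - 1) * r ^ 4 := by
      rw [← pow_add]
      congr 1
      omega
    have : (n : ℝ) ≠ 0 := by positivity
    rw [hp]
    field_simp
  · fun_prop
  · exact (continuous_finsetSum _ fun l _ => (hbc p l).mul (hbc q l)).aestronglyMeasurable
end
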